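/- arXiv:1703.08793 — 6 statements merged into one kernel-verified Lean document; each statement's English description precedes it below -/
import Mathlib

section
/- Let n ≥ 3, and let β : ℝ → (0,π) be a C² function with bounded first and second derivatives satisfying 0 < inf β ≤ sup β < π. For each τ ∈ ℝ set λ(τ) = inf{ (∫₀^{β(τ)} sin^{n−2}(t) v′(t)² dt) / (∫₀^{β(τ)} sin^{n−2}(t) v(t)² dt) : v ∈ C¹([0,β(τ)]), v(β(τ)) = 0, v not identically zero }, and assume that λ is C² on ℝ with λ, λ′, λ″ bounded and inf_{τ∈ℝ} λ(τ) > 0. For each τ let φ₁(τ,·) ∈ C²((0,β(τ))) ∩ C([0,β(τ)]) be the positive function with φ₁(τ, β(τ)) = 0, lim_{t→0⁺} ∂_t φ₁(τ,t) = 0, solving (d/dt)(sin^{n−2}(t) ∂_t φ₁(τ,t)) + λ(τ) sin^{n−2}(t) φ₁(τ,t) = 0 on (0,β(τ)), normalized so that ω_{n−2} ∫₀^{β(τ)} sin^{n−2}(t) φ₁(τ,t)² dt = 1, where ω_{n−2} is the total surface measure of the unit sphere S^{n−2}. Then the function ψ(τ,s) = φ₁(τ, s·β(τ)), defined for (τ,s)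 ∈ ℝ × (0,1), is twice differentiable with respect to τ, and there exists a constant C > 0 such that |ψ(τ,s)| + |∂_τ ψ(τ,s)| + |∂²_τ ψ(τ,s)| ≤ C for all τ ∈ ℝ and all s ∈ (0,1). -/
open Real MeasureTheory Filter

/-- The function `(z, x) ↦ ∑ₖ aₖ(z) xᵏ`. -/
noncomputable def parametricSeries (a : ℕ → ℂ → ℂ) (p : ℂ × ℂ) : ℂ :=
  ∑' k, a k p.1 * p.2 ^ k

/-- Entire coefficients for which `∑ₖ aₖ(z) xᵏ` converges normally on compact subsets of
`{(z, x) | ‖x‖ < 1}`. -/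
structure AdmissibleCoeff (a : ℕ → ℂ → ℂ) : Prop where
  differentiable : ∀ k, Differentiable ℂ (a k)
  bound : ∀ R r : ℝ, 0 < r → r < 1 →
    ∃ u : ℕ → ℝ, Summable u ∧ ∀ k z, ‖z‖ ≤ R → ‖a k z‖ * r ^ k ≤ u k

/-- The coefficients of the `x`-derivative of `∑ₖ aₖ(z) xᵏ`. -/
def shiftCoeff (a : ℕ → ℂ → ℂ) (k : ℕ) (z : ℂ) : ℂ := ((k : ℂ) + 1) * a (k + 1) z

/-- The coefficients of the `z`-derivative of `∑ₖ aₖ(z) xᵏ`. -/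
noncomputable def derivCoeff (a : ℕ → ℂ → ℂ) (k : ℕ) (z : ℂ) : ℂ := deriv (a k) z

namespace AdmissibleCoeff

variable {a : ℕ → ℂ → ℂ}

theorem fstDeriv (ha : AdmissibleCoeff a) : AdmissibleCoeff (derivCoeff a) where
  differentiable k := (ha.differentiable k).contDiff.differentiable_deriv_two
  bound R r hr0 hr1 := by
    obtain ⟨u, hu, hau⟩ := ha.bound (R + 1) r hr0 hr1
    refine ⟨u, hu, fun k z hz => ?_⟩
    have hrk : 0 < r ^ k := pow_pos hr0 k
    have h := Complex.norm_deriv_le_of_forall_mem_sphere_norm_le (c := z) (f := a k)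
      (C := u k / r ^ k) one_pos (ha.differentiable k).diffContOnCl fun w hw => by
        rw [le_div_iff₀ hrk]
        refine hau k w ?_
        have h1 : ‖w - z‖ = 1 := by simpa [dist_eq_norm] using hw
        calc ‖w‖ = ‖z + (w - z)‖ := by ring_nf
          _ ≤ ‖z‖ + ‖w - z‖ := norm_add_le _ _
          _ ≤ R + 1 := by linarith
    rw [div_one, le_div_iff₀ hrk] at h
    exact h

theorem sndDeriv (ha : AdmissibleCoeff a) : AdmissibleCoeff (shiftCoeff a) where
  differentiable k := (ha.differentiable (k + 1)).const_mul _
  bound R r hr0 hr1 := by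
    obtain ⟨s, hrs, hs1⟩ := exists_between hr1
    have hs0 : 0 < s := hr0.trans hrs
    obtain ⟨u, hu, hau⟩ := ha.bound R s hs0 hs1
    have hq : ‖r / s‖ < 1 := by
      rw [Real.norm_of_nonneg (by positivity), div_lt_one hs0]; exact hrs
    have hlim : Tendsto (fun k : ℕ => ((k : ℝ) + 1) * (r / s) ^ k) atTop (nhds 0) := by
      have h1 := (summable_pow_mul_geometric_of_norm_lt_one 1 hq).tendsto_atTop_zero
      have h2 := (summable_geometric_of_norm_lt_one hq).tendsto_atTop_zero
      simpa [add_mul] using h1.add h2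
    obtain ⟨C, hC⟩ := hlim.bddAbove_range
    refine ⟨fun k => C / s * u (k + 1), ((summable_nat_add_iff 1).2 hu).mul_left _,
      fun k z hz => ?_⟩
    have hk : ((k : ℝ) + 1) * (r / s) ^ k ≤ C := hC ⟨k, rfl⟩
    have hC0 : 0 ≤ C := le_trans (by positivity) hk
    have hn : ‖(k : ℂ) + 1‖ = (k : ℝ) + 1 := by exact_mod_cast Complex.norm_natCast (k + 1)
    calc ‖((k : ℂ) + 1) * a (k + 1) z‖ * r ^ k
        = (((k : ℝ) + 1) * (r / s) ^ k) / s * (‖a (k + 1) z‖ * s ^ (k + 1)) := by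
          rw [norm_mul, hn, div_pow, pow_succ]; field_simp
      _ ≤ C / s * u (k + 1) := by
          gcongr
          exact hau (k + 1) z hz

theorem norm_mul_pow_le {R r : ℝ} {u : ℕ → ℝ} (h : ∀ k z, ‖z‖ ≤ R → ‖a k z‖ * r ^ k ≤ u k)
    {z x : ℂ} (hz : ‖z‖ ≤ R) (hx : ‖x‖ ≤ r) (k : ℕ) : ‖a k z * x ^ k‖ ≤ u k := by
  refine le_trans ?_ (h k z hz)
  rw [norm_mul, norm_pow]
  gcongr

theorem exists_bound_nhds (ha : AdmissibleCoeff a) {p : ℂ × ℂ} (hp : ‖p.2‖ < 1) :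
    ∃ R r : ℝ, ‖p.1‖ < R ∧ ‖p.2‖ < r ∧ r < 1 ∧ ∃ u : ℕ → ℝ, Summable u ∧
      ∀ z x : ℂ, ‖z‖ ≤ R → ‖x‖ ≤ r → ∀ k, ‖a k z * x ^ k‖ ≤ u k := by
  obtain ⟨r, hr, hr1⟩ := exists_between hp
  obtain ⟨u, hu, hau⟩ := ha.bound (‖p.1‖ + 1) r ((norm_nonneg _).trans_lt hr) hr1
  exact ⟨‖p.1‖ + 1, r, by linarith, hr, hr1, u, hu, fun z x hz hx => norm_mul_pow_le hau hz hx⟩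

theorem hasSum (ha : AdmissibleCoeff a) {z x : ℂ} (hx : ‖x‖ < 1) :
    HasSum (fun k => a k z * x ^ k) (parametricSeries a (z, x)) := by
  obtain ⟨R, r, hR, hr, -, u, hu, hau⟩ := ha.exists_bound_nhds (p := (z, x)) hx
  exact (Summable.of_norm_bounded hu (hau z x hR.le hr.le)).hasSum

theorem continuousAt (ha : AdmissibleCoeff a) {p : ℂ × ℂ} (hp : ‖p.2‖ < 1) :
    ContinuousAt (parametricSeries a) p := by
  obtain ⟨R, r, hR, hr, -, u, hu, hau⟩ := ha.exists_bound_nhds hp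
  have hU : {q : ℂ × ℂ | ‖q.1‖ < R ∧ ‖q.2‖ < r} ∈ nhds p :=
    IsOpen.mem_nhds ((isOpen_lt continuous_fst.norm continuous_const).and
      (isOpen_lt continuous_snd.norm continuous_const)) ⟨hR, hr⟩
  refine ContinuousOn.continuousAt (continuousOn_tsum (fun k => ?_) hu fun k q hq =>
    hau q.1 q.2 hq.1.le hq.2.le k) hU
  have := (ha.differentiable k).continuous
  fun_prop

theorem hasDerivAt_fst (ha : AdmissibleCoeff a) {z x : ℂ} (hx : ‖x‖ < 1) :
    HasDerivAt (fun w => parametricSeries a (w, x))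
      (parametricSeries (derivCoeff a) (z, x)) z := by
  obtain ⟨R, r, hR, hr, -, u, hu, hau⟩ := ha.exists_bound_nhds (p := (z, x)) hx
  have hU : IsOpen (Metric.ball (0 : ℂ) R) := Metric.isOpen_ball
  have hz : z ∈ Metric.ball (0 : ℂ) R := by simpa using hR
  have hd : ∀ k, DifferentiableOn ℂ (fun w => a k w * x ^ k) (Metric.ball 0 R) := fun k =>
    ((ha.differentiable k).mul_const _).differentiableOn
  have hle : ∀ k w, w ∈ Metric.ball (0 : ℂ) R → ‖a k w * x ^ k‖ ≤ u k := fun k w hw =>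
    hau w x (by simpa using (mem_ball_zero_iff.1 hw).le) hr.le k
  have h1 := Complex.hasSum_deriv_of_summable_norm hu hd hU hle hz
  have h2 := (Complex.differentiableOn_tsum_of_summable_norm hu hd hU hle).differentiableAt
    (hU.mem_nhds hz)
  have h3 : (fun k => deriv (fun w => a k w * x ^ k) z) =
      fun k => derivCoeff a k z * x ^ k := by
    ext k
    simp [derivCoeff]
  rw [h3] at h1
  rw [← h1.unique (ha.fstDeriv.hasSum hx)]
  exact h2.hasDerivAt

theorem hasSum_snd_mul (ha : AdmissibleCoeff a) {z x : ℂ} (hx : ‖x‖ < 1) :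
    HasSum (fun k : ℕ => (k : ℂ) * a k z * x ^ k)
      (x * parametricSeries (shiftCoeff a) (z, x)) := by
  rw [← hasSum_nat_add_iff' 1]
  convert! (ha.sndDeriv.hasSum (z := z) hx).mul_left x using 1
  · ext k
    simp only [shiftCoeff]
    push_cast
    ring
  · simp

theorem hasDerivAt_snd (ha : AdmissibleCoeff a) {z x : ℂ} (hx : ‖x‖ < 1) :
    HasDerivAt (fun w => parametricSeries a (z, w))
      (parametricSeries (shiftCoeff a) (z, x)) x := by
  obtain ⟨R, r, hR, hr, -, u, hu, hau⟩ := ha.exists_bound_nhds (p := (z, x)) hx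
  have hU : IsOpen (Metric.ball (0 : ℂ) r) := Metric.isOpen_ball
  have hxr : x ∈ Metric.ball (0 : ℂ) r := by simpa using hr
  have hd : ∀ k, DifferentiableOn ℂ (fun w => a k z * w ^ k) (Metric.ball 0 r) := fun k => by
    fun_prop
  have hle : ∀ k w, w ∈ Metric.ball (0 : ℂ) r → ‖a k z * w ^ k‖ ≤ u k := fun k w hw =>
    hau z w hR.le (by simpa using (mem_ball_zero_iff.1 hw).le) k
  have h1 := Complex.hasSum_deriv_of_summable_norm hu hd hU hle hxr
  have h2 := (Complex.differentiableOn_tsum_of_summable_norm hu hd hU hle).differentiableAt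
    (hU.mem_nhds hxr)
  rw [← hasSum_nat_add_iff' 1] at h1
  have h3 : (fun k => deriv (fun w => a (k + 1) z * w ^ (k + 1)) x) =
      fun k => shiftCoeff a k z * x ^ k := by
    ext k
    simp [shiftCoeff]
    ring
  rw [h3] at h1
  have h4 := h1.unique (ha.sndDeriv.hasSum hx)
  simp only [Finset.range_one, Finset.sum_singleton, pow_zero, mul_one, deriv_const, sub_zero] at h4
  rw [← h4]
  exact h2.hasDerivAt

theorem isOpen_domain : IsOpen {p : ℂ × ℂ | ‖p.2‖ < 1} :=
  isOpen_lt (by fun_prop) (by fun_prop)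

theorem hasFDerivAt (ha : AdmissibleCoeff a) {p : ℂ × ℂ} (hp : ‖p.2‖ < 1) :
    HasFDerivAt (parametricSeries a)
      ((ContinuousLinearMap.toSpanSingleton ℂ (parametricSeries (derivCoeff a) p)).coprod
        (ContinuousLinearMap.toSpanSingleton ℂ (parametricSeries (shiftCoeff a) p))) p := by
  have hU := isOpen_domain.mem_nhds hp
  refine (hasStrictFDerivAt_uncurry_coprod (𝕜 := ℂ) (f := fun z x => parametricSeries a (z, x))
    (f₁ := fun z x => ContinuousLinearMap.toSpanSingleton ℂ
      (parametricSeries (derivCoeff a) (z, x)))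
    (f₂ := fun z x => ContinuousLinearMap.toSpanSingleton ℂ
      (parametricSeries (shiftCoeff a) (z, x))) ?_ ?_ ?_ ?_).hasFDerivAt
  · filter_upwards [hU] with q hq using (ha.hasDerivAt_fst hq).hasFDerivAt
  · filter_upwards [hU] with q hq using (ha.hasDerivAt_snd hq).hasFDerivAt
  · exact (ContinuousLinearMap.toSpanSingletonCLE (𝕜 := ℂ) (E := ℂ)).continuous.continuousAt.comp
      (ha.fstDeriv.continuousAt hp)
  · exact (ContinuousLinearMap.toSpanSingletonCLE (𝕜 := ℂ) (E := ℂ)).continuous.continuousAt.comp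
      (ha.sndDeriv.continuousAt hp)

theorem contDiffOn (ha : AdmissibleCoeff a) (m : ℕ) :
    ContDiffOn ℂ m (parametricSeries a) {p : ℂ × ℂ | ‖p.2‖ < 1} := by
  induction m generalizing a with
  | zero => exact contDiffOn_zero.2 fun p hp => (ha.continuousAt hp).continuousWithinAt
  | succ m ih =>
    rw [Nat.cast_succ, contDiffOn_succ_iff_fderiv_of_isOpen isOpen_domain]
    refine ⟨fun p hp => (ha.hasFDerivAt hp).differentiableAt.differentiableWithinAt,
      by simp, ContDiffOn.congr ?_ fun p hp => (ha.hasFDerivAt hp).fderiv⟩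
    have hL := (ContinuousLinearMap.toSpanSingletonCLE (𝕜 := ℂ) (E := ℂ)).contDiff (n := m)
    have h1 := hL.comp_contDiffOn (ih ha.fstDeriv)
    have h2 := hL.comp_contDiffOn (ih ha.sndDeriv)
    exact (ContinuousLinearMap.coprodEquivL (𝕜 := ℂ) (S := ℂ) (E := ℂ) (F := ℂ)
      (G := ℂ)).contDiff.comp_contDiffOn (h1.prodMk h2)

end AdmissibleCoeff

/-- If `a` solves the (inhomogeneous) hypergeometric recursion then `∑ₖ aₖ(z) xᵏ` solves the
corresponding differential equation. -/
theorem AdmissibleCoeff.hypergeometric_ode {a b : ℕ → ℂ → ℂ} (ha : AdmissibleCoeff a)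
    (hb : AdmissibleCoeff b) {m z x : ℂ}
    (hab : ∀ k : ℕ, ((k : ℂ) + 1) * (k + (m + 1) / 2) * a (k + 1) z =
      (k * (k + m) - z) * a k z - b k z) (hx : ‖x‖ < 1) :
    x * (1 - x) * parametricSeries (shiftCoeff (shiftCoeff a)) (z, x)
      + (m + 1) / 2 * (1 - 2 * x) * parametricSeries (shiftCoeff a) (z, x)
      + z * parametricSeries a (z, x) + parametricSeries b (z, x) = 0 := by
  have h0 := ha.hasSum (z := z) hx
  have hb0 := hb.hasSum (z := z) hx
  have h1 := ha.sndDeriv.hasSum (z := z) hx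
  have h1x := ha.hasSum_snd_mul (z := z) hx
  have h2x := ha.sndDeriv.hasSum_snd_mul (z := z) hx
  have h2xx : HasSum (fun k : ℕ => ((k : ℂ) - 1) * k * a k z * x ^ k)
      (x * (x * parametricSeries (shiftCoeff (shiftCoeff a)) (z, x))) := by
    rw [← hasSum_nat_add_iff' 1]
    convert! h2x.mul_left x using 1
    · ext k
      simp only [shiftCoeff]
      push_cast
      ring
    · simp
  have h := (((h2x.sub h2xx).add ((h1.sub (h1x.mul_left 2)).mul_left ((m + 1) / 2))).add
    (h0.mul_left z)).add hb0
  have h' := h.unique (hasSum_zero.congr_fun fun k => ?_)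
  · linear_combination h'
  · simp only [shiftCoeff]
    linear_combination x ^ k * hab k

/-- The coefficients of the hypergeometric series solving
`x (1 - x) ∂²y + (m + 1) / 2 * (1 - 2 x) ∂y + z y = 0`. -/
noncomputable def hyperCoeff (m : ℕ) : ℕ → ℂ → ℂ
  | 0, _ => 1
  | k + 1, z => (k * (k + m) - z) / ((k + 1) * (k + (m + 1) / 2)) * hyperCoeff m k z

theorem hyperCoeff_den_ne_zero (m k : ℕ) : ((k : ℂ) + 1) * (k + (m + 1) / 2) ≠ 0 := by
  have h : (0 : ℝ) < ((k : ℝ) + 1) * (k + (m + 1) / 2) := by positivity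
  have h' := Complex.ofReal_ne_zero.2 h.ne'
  push_cast at h'
  exact h'

theorem hyperCoeff_succ (m k : ℕ) (z : ℂ) :
    ((k : ℂ) + 1) * (k + (m + 1) / 2) * hyperCoeff m (k + 1) z =
      (k * (k + m) - z) * hyperCoeff m k z := by
  rw [hyperCoeff, ← mul_assoc, mul_div_cancel₀ _ (hyperCoeff_den_ne_zero m k)]

theorem differentiable_hyperCoeff (m k : ℕ) : Differentiable ℂ (hyperCoeff m k) := by
  induction k with
  | zero => exact differentiable_const _
  | succ k ih =>
    exact (((differentiable_const _).sub differentiable_id).div_const _).mul ih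

theorem derivCoeff_hyperCoeff_succ (m k : ℕ) (z : ℂ) :
    ((k : ℂ) + 1) * (k + (m + 1) / 2) * derivCoeff (hyperCoeff m) (k + 1) z =
      (k * (k + m) - z) * derivCoeff (hyperCoeff m) k z - hyperCoeff m k z := by
  have h1 := (differentiable_hyperCoeff m (k + 1) z).hasDerivAt.const_mul
    (((k : ℂ) + 1) * (k + (m + 1) / 2))
  have h2 := ((hasDerivAt_id z).const_sub ((k : ℂ) * (k + m))).mul
    (differentiable_hyperCoeff m k z).hasDerivAt
  have h3 : (fun w => ((k : ℂ) + 1) * (k + (m + 1) / 2) * hyperCoeff m (k + 1) w) =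
      fun w => ((k : ℂ) * (k + m) - w) * hyperCoeff m k w := funext fun w => hyperCoeff_succ m k w
  rw [h3] at h1
  have h4 := h1.unique h2
  simp only [derivCoeff]
  rw [h4]
  simp only [id]
  ring

/-- A positive majorant of `hyperCoeff`. -/
noncomputable def hyperMajorant (m : ℕ) (R : ℝ) : ℕ → ℝ
  | 0 => 1
  | k + 1 => (k * (k + m) + R) / ((k + 1) * (k + (m + 1) / 2)) * hyperMajorant m R k

theorem hyperMajorant_pos (m : ℕ) {R : ℝ} (hR : 0 < R) (k : ℕ) : 0 < hyperMajorant m R k := by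
  induction k with
  | zero => exact one_pos
  | succ k ih => rw [hyperMajorant]; positivity

theorem norm_hyperCoeff_le (m k : ℕ) {R : ℝ} {z : ℂ} (hz : ‖z‖ ≤ R) :
    ‖hyperCoeff m k z‖ ≤ hyperMajorant m R k := by
  have hR : 0 ≤ R := (norm_nonneg z).trans hz
  induction k with
  | zero => simp [hyperCoeff, hyperMajorant]
  | succ k ih =>
    rw [hyperCoeff, hyperMajorant, norm_mul, norm_div]
    have hden : ‖((k : ℂ) + 1) * (k + (m + 1) / 2)‖ = ((k : ℝ) + 1) * (k + (m + 1) / 2) := by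
      have h : (0 : ℝ) ≤ ((k : ℝ) + 1) * (k + (m + 1) / 2) := by positivity
      rw [← Complex.norm_of_nonneg h]
      push_cast
      rfl
    have hnum : ‖(k : ℂ) * (k + m) - z‖ ≤ (k : ℝ) * (k + m) + R := by
      refine (norm_sub_le _ _).trans (add_le_add ?_ hz)
      exact_mod_cast (Complex.norm_natCast (k * (k + m))).le
    rw [hden]
    gcongr

theorem summable_hyperMajorant (m : ℕ) {R r : ℝ} (hR : 0 < R) (hr0 : 0 < r) (hr1 : r < 1) :
    Summable fun k => hyperMajorant m R k * r ^ k := by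
  refine summable_of_ratio_test_tendsto_lt_one hr1
    (Eventually.of_forall fun k => (mul_pos (hyperMajorant_pos m hR k) (pow_pos hr0 k)).ne') ?_
  have h1 : (fun k : ℕ => ‖hyperMajorant m R (k + 1) * r ^ (k + 1)‖ /
      ‖hyperMajorant m R k * r ^ k‖) = fun k : ℕ =>
      ((k : ℝ) * (k + m) + R) / ((k + 1) * (k + (m + 1) / 2)) * r := by
    ext k
    have hk := hyperMajorant_pos m hR k
    have hk' := hyperMajorant_pos m hR (k + 1)
    rw [Real.norm_of_nonneg (by positivity), Real.norm_of_nonneg (by positivity), hyperMajorant]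
    field_simp
    ring
  rw [h1]
  have hinv : Tendsto (fun k : ℕ => (k : ℝ)⁻¹) atTop (nhds 0) :=
    tendsto_inv_atTop_zero.comp tendsto_natCast_atTop_atTop
  have h2 : Tendsto (fun k : ℕ => (1 * (1 + m * (k : ℝ)⁻¹) + R * (k : ℝ)⁻¹ * (k : ℝ)⁻¹) /
      ((1 + (k : ℝ)⁻¹) * (1 + (m + 1) / 2 * (k : ℝ)⁻¹)) * r) atTop
      (nhds ((1 * (1 + m * 0) + R * 0 * 0) / ((1 + 0) * (1 + ((m : ℝ) + 1) / 2 * 0)) * r)) := by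
    refine Tendsto.mul_const _ (Tendsto.div ?_ ?_ (by norm_num))
    · exact ((tendsto_const_nhds.add (hinv.const_mul _)).const_mul _).add
        ((hinv.const_mul R).mul hinv)
    · exact (tendsto_const_nhds.add hinv).mul (tendsto_const_nhds.add (hinv.const_mul _))
  have h3 : (1 * (1 + (m : ℝ) * 0) + R * 0 * 0) /
      ((1 + 0) * (1 + ((m : ℝ) + 1) / 2 * 0)) * r = r := by
    simp
  rw [h3] at h2
  refine h2.congr' ?_
  filter_upwards [eventually_gt_atTop 0] with k hk
  have hk' : (0 : ℝ) < k := by exact_mod_cast hk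
  field_simp

theorem admissibleCoeff_hyperCoeff (m : ℕ) : AdmissibleCoeff (hyperCoeff m) where
  differentiable := differentiable_hyperCoeff m
  bound R r hr0 hr1 := by
    refine ⟨_, summable_hyperMajorant m (R := |R| + 1) (by positivity) hr0 hr1, fun k z hz => ?_⟩
    gcongr
    exact norm_hyperCoeff_le m k (hz.trans ((le_abs_self R).trans (by linarith)))

/-- The real function `(l, t) ↦ ∑ₖ aₖ(l) xᵏ` with `x = (1 - cos t) / 2 = sin² (t / 2)`. -/
noncomputable def capSeries (a : ℕ → ℂ → ℂ) (p : ℝ × ℝ) : ℝ :=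
  (parametricSeries a ((p.1 : ℂ), (((1 - Real.cos p.2) / 2 : ℝ) : ℂ))).re

theorem norm_half_one_sub_cos_lt_one {t : ℝ} (ht : t ∈ Set.Ioo (-π) π) :
    ‖(((1 - Real.cos t) / 2 : ℝ) : ℂ)‖ < 1 := by
  have h1 : -1 < Real.cos t := by
    rw [← Real.cos_abs, ← Real.cos_pi]
    exact Real.cos_lt_cos_of_nonneg_of_le_pi (abs_nonneg t) le_rfl (abs_lt.2 ht)
  have h2 := Real.cos_le_one t
  rw [Complex.norm_of_nonneg (by linarith)]
  linarith

namespace AdmissibleCoeff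

variable {a b : ℕ → ℂ → ℂ}

theorem capSeries_contDiffOn (ha : AdmissibleCoeff a) (m : ℕ) :
    ContDiffOn ℝ m (capSeries a) {p : ℝ × ℝ | p.2 ∈ Set.Ioo (-π) π} := by
  have h1 : ContDiff ℝ m
      (fun p : ℝ × ℝ => ((p.1 : ℂ), (((1 - Real.cos p.2) / 2 : ℝ) : ℂ))) := by
    refine (Complex.ofRealCLM.contDiff.comp contDiff_fst).prodMk
      (Complex.ofRealCLM.contDiff.comp (f := fun p : ℝ × ℝ => (1 - Real.cos p.2) / 2) ?_)
    exact (contDiff_const.sub (Real.contDiff_cos.comp contDiff_snd)).div_const _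
  exact Complex.reCLM.contDiff.comp_contDiffOn
    (((ha.contDiffOn m).restrict_scalars ℝ).comp h1.contDiffOn
      fun p hp => norm_half_one_sub_cos_lt_one hp)

theorem capSeries_hasDerivAt (ha : AdmissibleCoeff a) (l : ℝ) {t : ℝ} (ht : t ∈ Set.Ioo (-π) π) :
    HasDerivAt (fun s => capSeries a (l, s))
      (capSeries (shiftCoeff a) (l, t) * (Real.sin t / 2)) t := by
  have h1 := (ha.hasDerivAt_snd (z := l) (norm_half_one_sub_cos_lt_one ht)).real_of_complex
  have h2 : HasDerivAt (fun s => (1 - Real.cos s) / 2) (Real.sin t / 2) t := by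
    simpa using ((Real.hasDerivAt_cos t).const_sub 1).div_const 2
  exact h1.comp t h2

theorem capSeries_ode (ha : AdmissibleCoeff a) (hb : AdmissibleCoeff b) {m : ℕ} {l : ℝ}
    (hab : ∀ k : ℕ, ((k : ℂ) + 1) * (k + (m + 1) / 2) * a (k + 1) l =
      (k * (k + m) - l) * a k l - b k l) {t : ℝ} (ht : t ∈ Set.Ioo (-π) π) :
    HasDerivAt (fun s => Real.sin s ^ m * (capSeries (shiftCoeff a) (l, s) *
        (Real.sin s / 2)))
      (-(Real.sin t ^ m * (l * capSeries a (l, t) + capSeries b (l, t)))) t := by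
  have hode := congrArg Complex.re
    (ha.hypergeometric_ode hb hab (norm_half_one_sub_cos_lt_one ht))
  set x : ℝ := (1 - Real.cos t) / 2 with hx
  have hre : x * (1 - x) * capSeries (shiftCoeff (shiftCoeff a)) (l, t)
      + (m + 1) / 2 * (1 - 2 * x) * capSeries (shiftCoeff a) (l, t)
      + l * capSeries a (l, t) + capSeries b (l, t) = 0 := by
    have e1 : (x : ℂ) * (1 - x) = ((x * (1 - x) : ℝ) : ℂ) := by push_cast; ring
    have e2 : ((m : ℂ) + 1) / 2 * (1 - 2 * x) = (((m + 1) / 2 * (1 - 2 * x) : ℝ) : ℂ) := by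
      push_cast; ring
    rw [e1, e2] at hode
    simp only [Complex.add_re, Complex.re_ofReal_mul, Complex.zero_re] at hode
    exact hode
  have hd := ((Real.hasDerivAt_sin t).pow m).mul ((ha.sndDeriv.capSeries_hasDerivAt l ht).mul
    ((Real.hasDerivAt_sin t).div_const 2))
  refine hd.congr_deriv ?_
  have hs : Real.sin t ^ 2 = 4 * (x * (1 - x)) := by
    rw [Real.sin_sq, hx]; ring
  have hc : Real.cos t = 1 - 2 * x := by rw [hx]; ring
  have hm : (m : ℝ) * Real.sin t ^ (m - 1) * Real.sin t = m * Real.sin t ^ m := by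
    rcases m with _ | m
    · simp
    · rw [Nat.add_sub_cancel, mul_assoc, ← pow_succ]
  simp only [Pi.mul_apply, Pi.pow_apply]
  linear_combination Real.sin t ^ m * hre
    + Real.cos t * capSeries (shiftCoeff a) (l, t) / 2 * hm
    + Real.sin t ^ m * capSeries (shiftCoeff (shiftCoeff a)) (l, t) / 4 * hs
    + Real.sin t ^ m * (m + 1) / 2 * capSeries (shiftCoeff a) (l, t) * hc

end AdmissibleCoeff

theorem capSeries_hyperCoeff_zero (m : ℕ) (l : ℝ) : capSeries (hyperCoeff m) (l, 0) = 1 := by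
  have h : parametricSeries (hyperCoeff m) ((l : ℂ), 0) = 1 := by
    rw [parametricSeries, tsum_eq_single 0 fun k hk => by simp [hk]]
    simp [hyperCoeff]
  simp [capSeries, h]

/-- An antiderivative in `t` of `sinᵐ(t) F(l, t)²`, where `F = capSeries (hyperCoeff m)`. -/
noncomputable def capEnergy (m : ℕ) (p : ℝ × ℝ) : ℝ :=
  capSeries (shiftCoeff (hyperCoeff m)) p * (Real.sin p.2 ^ m * (Real.sin p.2 / 2)) *
      capSeries (derivCoeff (hyperCoeff m)) p
    - capSeries (shiftCoeff (derivCoeff (hyperCoeff m))) p *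
      (Real.sin p.2 ^ m * (Real.sin p.2 / 2)) * capSeries (hyperCoeff m) p

theorem capEnergy_contDiffOn (m k : ℕ) :
    ContDiffOn ℝ k (capEnergy m) {p : ℝ × ℝ | p.2 ∈ Set.Ioo (-π) π} := by
  have hc := admissibleCoeff_hyperCoeff m
  have hsin : ContDiffOn ℝ k (fun p : ℝ × ℝ => Real.sin p.2 ^ m * (Real.sin p.2 / 2))
      {p : ℝ × ℝ | p.2 ∈ Set.Ioo (-π) π} := by
    have h := Real.contDiff_sin.comp (contDiff_snd (𝕜 := ℝ) (E := ℝ) (F := ℝ) (n := k))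
    exact ((h.pow m).mul (h.div_const 2)).contDiffOn
  exact (((hc.sndDeriv.capSeries_contDiffOn k).mul hsin).mul
    (hc.fstDeriv.capSeries_contDiffOn k)).sub
    (((hc.fstDeriv.sndDeriv.capSeries_contDiffOn k).mul hsin).mul (hc.capSeries_contDiffOn k))

theorem admissibleCoeff_zero : AdmissibleCoeff (fun _ _ => 0) where
  differentiable _ := differentiable_const _
  bound _ _ _ _ := ⟨0, summable_zero, by simp⟩

theorem capSeries_zero (p : ℝ × ℝ) : capSeries (fun _ _ => 0) p = 0 := by
  simp [capSeries, parametricSeries]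

theorem capSeries_hyperCoeff_ode (m : ℕ) (l : ℝ) {t : ℝ} (ht : t ∈ Set.Ioo (-π) π) :
    HasDerivAt (fun s => Real.sin s ^ m * (capSeries (shiftCoeff (hyperCoeff m)) (l, s) *
        (Real.sin s / 2)))
      (-(Real.sin t ^ m * (l * capSeries (hyperCoeff m) (l, t)))) t := by
  simpa only [capSeries_zero, add_zero] using
    (admissibleCoeff_hyperCoeff m).capSeries_ode admissibleCoeff_zero
      (fun k => by simpa using hyperCoeff_succ m k l) ht

theorem capEnergy_hasDerivAt (m : ℕ) (l : ℝ) {t : ℝ} (ht : t ∈ Set.Ioo (-π) π) :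
    HasDerivAt (fun s => capEnergy m (l, s))
      (Real.sin t ^ m * capSeries (hyperCoeff m) (l, t) ^ 2) t := by
  have hc := admissibleCoeff_hyperCoeff m
  have h1 := capSeries_hyperCoeff_ode m l ht
  have h2 := hc.fstDeriv.capSeries_ode hc (l := l)
    (fun k => derivCoeff_hyperCoeff_succ m k l) ht
  have h := (h1.mul (hc.fstDeriv.capSeries_hasDerivAt l ht)).sub
    (h2.mul (hc.capSeries_hasDerivAt l ht))
  refine (h.congr_deriv ?_).congr_of_eventuallyEq (Eventually.of_forall fun s => ?_)
  · ring
  · simp only [capEnergy, Pi.sub_apply, Pi.mul_apply]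
    ring

theorem capSeries_hyperCoeff_continuousOn (m : ℕ) (l : ℝ) :
    ContinuousOn (fun t => capSeries (hyperCoeff m) (l, t)) (Set.Ioo (-π) π) := fun _ ht =>
  ((admissibleCoeff_hyperCoeff m).capSeries_hasDerivAt l ht).continuousAt.continuousWithinAt

theorem integral_sin_pow_mul_capSeries_sq (m : ℕ) (l : ℝ) {b : ℝ} (hb : b ∈ Set.Ioo 0 π) :
    ∫ t in (0 : ℝ)..b, Real.sin t ^ m * capSeries (hyperCoeff m) (l, t) ^ 2 =
      capEnergy m (l, b) := by
  have hsub : Set.uIcc 0 b ⊆ Set.Ioo (-π) π := by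
    rw [Set.uIcc_of_le hb.1.le]
    exact fun t ht => ⟨by linarith [ht.1, Real.pi_pos], ht.2.trans_lt hb.2⟩
  rw [intervalIntegral.integral_eq_sub_of_hasDerivAt
    (fun t ht => capEnergy_hasDerivAt m l (hsub ht))]
  · simp [capEnergy]
  · refine ContinuousOn.intervalIntegrable ?_
    exact (Real.continuous_sin.pow m).continuousOn.mul
      (((capSeries_hyperCoeff_continuousOn m l).mono hsub).pow 2)

theorem capEnergy_pos (m : ℕ) (l : ℝ) {b : ℝ} (hb : b ∈ Set.Ioo 0 π) :
    0 < capEnergy m (l, b) := by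
  rw [← integral_sin_pow_mul_capSeries_sq m l hb]
  have hcont := capSeries_hyperCoeff_continuousOn m l
  have hsub : Set.Icc 0 b ⊆ Set.Ioo (-π) π :=
    fun t ht => ⟨by linarith [ht.1, Real.pi_pos], ht.2.trans_lt hb.2⟩
  have hsin : ∀ t ∈ Set.Ioc 0 b, 0 < Real.sin t := fun t ht =>
    Real.sin_pos_of_pos_of_lt_pi ht.1 (ht.2.trans_lt hb.2)
  refine intervalIntegral.integral_pos hb.1 ?_ (fun t ht => ?_) ?_
  · exact (Real.continuous_sin.pow m).continuousOn.mul ((hcont.mono hsub).pow 2)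
  · exact mul_nonneg (pow_nonneg (hsin t ht).le m) (sq_nonneg _)
  · have h0 : ContinuousAt (fun t => capSeries (hyperCoeff m) (l, t)) 0 :=
      hcont.continuousAt (Ioo_mem_nhds (by linarith [Real.pi_pos]) Real.pi_pos)
    have h1 : ∀ᶠ t in nhdsWithin 0 (Set.Ioi 0), capSeries (hyperCoeff m) (l, t) ≠ 0 :=
      (h0.eventually_ne (by simp [capSeries_hyperCoeff_zero])).filter_mono nhdsWithin_le_nhds
    obtain ⟨t, ht, htb⟩ := (h1.and (Ioo_mem_nhdsGT hb.1)).exists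
    exact ⟨t, Set.Ioo_subset_Icc_self htb,
      mul_pos (pow_pos (hsin t (Set.Ioo_subset_Ioc_self htb)) m) (by positivity)⟩

/-- A positive solution of the singular Sturm–Liouville problem that is regular at `0` is a
positive multiple of the hypergeometric one. -/
theorem exists_eq_mul_capSeries {m : ℕ} {l b : ℝ} (hb : b ∈ Set.Ioo 0 π) {φ : ℝ → ℝ}
    (hreg : ContDiffOn ℝ 2 φ (Set.Ioo 0 b)) (hcont : ContinuousOn φ (Set.Icc 0 b))
    (hpos : ∀ t ∈ Set.Ioo 0 b, 0 < φ t)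
    (hneu : Tendsto (fun t => deriv φ t) (nhdsWithin 0 (Set.Ioo 0 b)) (nhds 0))
    (hode : ∀ t ∈ Set.Ioo 0 b, deriv (fun s => Real.sin s ^ m * deriv φ s) t
      + l * (Real.sin t ^ m * φ t) = 0) :
    ∃ k : ℝ, 0 < k ∧ ∀ t ∈ Set.Ioo 0 b, φ t = k * capSeries (hyperCoeff m) (l, t) := by
  have hc := admissibleCoeff_hyperCoeff m
  set F : ℝ → ℝ := fun t => capSeries (hyperCoeff m) (l, t) with hF
  set F' : ℝ → ℝ := fun t => capSeries (shiftCoeff (hyperCoeff m)) (l, t) * (Real.sin t / 2)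
    with hF'
  have hsub : Set.Ioo 0 b ⊆ Set.Ioo (-π) π :=
    fun t ht => ⟨by linarith [ht.1, Real.pi_pos], ht.2.trans hb.2⟩
  have h0mem : (0 : ℝ) ∈ Set.Ioo (-π) π := ⟨by linarith [Real.pi_pos], Real.pi_pos⟩
  have hFd : ∀ t ∈ Set.Ioo (-π) π, HasDerivAt F (F' t) t := fun t ht =>
    hc.capSeries_hasDerivAt l ht
  have hF0 : F 0 = 1 := capSeries_hyperCoeff_zero m l
  have hne : (nhdsWithin (0 : ℝ) (Set.Ioo 0 b)).NeBot := by
    rw [nhdsWithin_Ioo_eq_nhdsGT hb.1]; infer_instance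
  have hφd : ∀ t ∈ Set.Ioo 0 b, HasDerivAt φ (deriv φ t) t := fun t ht =>
    ((hreg.differentiableOn (by norm_num)).differentiableAt
      (isOpen_Ioo.mem_nhds ht)).hasDerivAt
  have hφdd : ∀ t ∈ Set.Ioo 0 b, DifferentiableAt ℝ (deriv φ) t := fun t ht =>
    ((hreg.deriv_of_isOpen isOpen_Ioo (m := 1) (by norm_num)).differentiableOn
      (by norm_num)).differentiableAt (isOpen_Ioo.mem_nhds ht)
  have hpφ : ∀ t ∈ Set.Ioo 0 b, HasDerivAt (fun s => Real.sin s ^ m * deriv φ s)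
      (-(l * (Real.sin t ^ m * φ t))) t := fun t ht => by
    rw [← eq_neg_of_add_eq_zero_left (hode t ht)]
    exact DifferentiableAt.hasDerivAt
      ((Real.differentiableAt_sin.pow m).mul (hφdd t ht))
  set W : ℝ → ℝ := fun s => Real.sin s ^ m * deriv φ s * F s - Real.sin s ^ m * F' s * φ s with hW
  have hWd : ∀ t ∈ Set.Ioo 0 b, HasDerivAt W 0 t := fun t ht => by
    have h := ((hpφ t ht).mul (hFd t (hsub ht))).sub
      ((capSeries_hyperCoeff_ode m l (hsub ht)).mul (hφd t ht))
    refine h.congr_deriv ?_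
    simp only [hF, hF']
    ring
  have hφ0 : Tendsto φ (nhdsWithin 0 (Set.Ioo 0 b)) (nhds (φ 0)) :=
    (hcont 0 ⟨le_rfl, hb.1.le⟩).mono_left (nhdsWithin_mono _ Set.Ioo_subset_Icc_self)
  have hFlim : Tendsto F (nhdsWithin 0 (Set.Ioo 0 b)) (nhds (F 0)) :=
    (hFd 0 h0mem).continuousAt.tendsto.mono_left nhdsWithin_le_nhds
  have hW0 : Tendsto W (nhdsWithin 0 (Set.Ioo 0 b)) (nhds 0) := by
    have hp : Tendsto (fun s => Real.sin s ^ m) (nhdsWithin 0 (Set.Ioo 0 b))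
        (nhds (Real.sin 0 ^ m)) :=
      (Real.continuous_sin.pow m).continuousAt.tendsto.mono_left nhdsWithin_le_nhds
    have hpF' := (capSeries_hyperCoeff_ode m l h0mem).continuousAt.tendsto.mono_left
      (nhdsWithin_le_nhds (s := Set.Ioo 0 b))
    have h := ((hp.mul hneu).mul hFlim).sub (hpF'.mul hφ0)
    simpa using h
  have hconst : ∀ g : ℝ → ℝ, (∀ t ∈ Set.Ioo 0 b, HasDerivAt g 0 t) → ∀ L : ℝ,
      Tendsto g (nhdsWithin 0 (Set.Ioo 0 b)) (nhds L) → ∀ t ∈ Set.Ioo 0 b, g t = L := by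
    intro g hg L hL t ht
    refine tendsto_nhds_unique (tendsto_const_nhds.congr' ?_) hL
    filter_upwards [self_mem_nhdsWithin] with s hs
    exact isOpen_Ioo.is_const_of_deriv_eq_zero isPreconnected_Ioo
      (fun r hr => (hg r hr).differentiableAt.differentiableWithinAt)
      (fun r hr => (hg r hr).deriv) ht hs
  have hW_eq := hconst W hWd 0 hW0
  have hquot : ∀ t ∈ Set.Ioo 0 b, HasDerivAt (fun s => F s / φ s) 0 t := fun t ht => by
    refine ((hFd t (hsub ht)).div (hφd t ht) (hpos t ht).ne').congr_deriv ?_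
    have hs : 0 < Real.sin t ^ m :=
      pow_pos (Real.sin_pos_of_pos_of_lt_pi ht.1 (ht.2.trans hb.2)) m
    have h1 : Real.sin t ^ m * (F' t * φ t - F t * deriv φ t) = 0 := by
      linear_combination -hW_eq t ht
    rw [(mul_eq_zero.1 h1).resolve_left hs.ne', zero_div]
  obtain ⟨q, hq⟩ : ∃ q, ∀ t ∈ Set.Ioo 0 b, F t / φ t = q :=
    ⟨F (b / 2) / φ (b / 2), fun t ht => isOpen_Ioo.is_const_of_deriv_eq_zero isPreconnected_Ioo
      (fun r hr => (hquot r hr).differentiableAt.differentiableWithinAt)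
      (fun r hr => (hquot r hr).deriv) ht ⟨by linarith [hb.1], by linarith [hb.1]⟩⟩
  have hFq : ∀ t ∈ Set.Ioo 0 b, F t = q * φ t := fun t ht => by
    rw [← hq t ht, div_mul_cancel₀ _ (hpos t ht).ne']
  have h1 : 1 = q * φ 0 := by
    rw [← hF0]
    refine tendsto_nhds_unique hFlim ((hφ0.const_mul q).congr' ?_)
    filter_upwards [self_mem_nhdsWithin] with s hs using (hFq s hs).symm
  have hφ0' : 0 ≤ φ 0 := ge_of_tendsto hφ0 (by
    filter_upwards [self_mem_nhdsWithin] with s hs using (hpos s hs).le)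
  have hqpos : 0 < q := by
    by_contra! h
    nlinarith [mul_nonneg (neg_nonneg.2 h) hφ0']
  refine ⟨q⁻¹, inv_pos.2 hqpos, fun t ht => ?_⟩
  have := hFq t ht
  simp only [hF] at this
  rw [this, inv_mul_cancel_left₀ hqpos.ne']

/-- Composing a `C²` function with a family of curves that stay in a fixed compact set and have
bounded first and second derivatives yields functions that are uniformly bounded together with
their first two derivatives. -/
theorem exists_bound_deriv_comp {ι E : Type*} [NormedAddCommGroup E] [NormedSpace ℝ E]
    {H : E → ℝ} {U K : Set E} (hU : IsOpen U) (hH : ContDiffOn ℝ 2 H U) (hK : IsCompact K)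
    (hKU : K ⊆ U) {c : ι → ℝ → E} (hc : ∀ i, ContDiff ℝ 2 (c i)) (hcK : ∀ i t, c i t ∈ K)
    {A : ℝ} (hA : ∀ i t, ‖deriv (c i) t‖ ≤ A) (hA' : ∀ i t, ‖deriv (deriv (c i)) t‖ ≤ A) :
    (∀ i t, DifferentiableAt ℝ (fun s => H (c i s)) t ∧
      DifferentiableAt ℝ (deriv fun s => H (c i s)) t) ∧
    ∃ C > (0 : ℝ), ∀ i t, |H (c i t)| + |deriv (fun s => H (c i s)) t|
      + |deriv (deriv fun s => H (c i s)) t| ≤ C := by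
  have hcU : ∀ i t, c i t ∈ U := fun i t => hKU (hcK i t)
  have hcomp : ∀ i, ContDiff ℝ 2 (fun s => H (c i s)) := fun i =>
    contDiffOn_univ.1 (hH.comp (hc i).contDiffOn fun t _ => hcU i t)
  have hDH : ContDiffOn ℝ 1 (fderiv ℝ H) U :=
    hH.fderiv_of_isOpen hU (by norm_num)
  have hDDH : ContDiffOn ℝ 0 (fderiv ℝ (fderiv ℝ H)) U :=
    hDH.fderiv_of_isOpen hU (by norm_num)
  have hc1 : ∀ i t, HasDerivAt (c i) (deriv (c i) t) t := fun i t =>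
    ((hc i).differentiable (by norm_num) t).hasDerivAt
  have hc2 : ∀ i t, HasDerivAt (deriv (c i)) (deriv (deriv (c i)) t) t := fun i t =>
    ((hc i).differentiable_deriv_two t).hasDerivAt
  have hd1 : ∀ i t, HasDerivAt (fun s => H (c i s)) (fderiv ℝ H (c i t) (deriv (c i) t)) t :=
    fun i t => (((hH.differentiableOn (by norm_num)).differentiableAt
      (hU.mem_nhds (hcU i t))).hasFDerivAt).comp_hasDerivAt t (hc1 i t)
  have hd1' : ∀ i, (deriv fun s => H (c i s)) = fun t => fderiv ℝ H (c i t) (deriv (c i) t) :=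
    fun i => funext fun t => (hd1 i t).deriv
  have hd2 : ∀ i t, HasDerivAt (deriv fun s => H (c i s))
      (fderiv ℝ (fderiv ℝ H) (c i t) (deriv (c i) t) (deriv (c i) t)
        + fderiv ℝ H (c i t) (deriv (deriv (c i)) t)) t := fun i t => by
    rw [hd1' i]
    exact HasDerivAt.clm_apply ((((hDH.differentiableOn (by norm_num)).differentiableAt
      (hU.mem_nhds (hcU i t))).hasFDerivAt).comp_hasDerivAt t (hc1 i t)) (hc2 i t)
  refine ⟨fun i t => ⟨(hd1 i t).differentiableAt, (hd2 i t).differentiableAt⟩, ?_⟩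
  obtain ⟨C₀, hC₀⟩ := hK.exists_bound_of_continuousOn (hH.continuousOn.mono hKU)
  obtain ⟨C₁, hC₁⟩ := hK.exists_bound_of_continuousOn (hDH.continuousOn.mono hKU)
  obtain ⟨C₂, hC₂⟩ := hK.exists_bound_of_continuousOn
    (f := fderiv ℝ (fderiv ℝ H)) (hDDH.continuousOn.mono hKU)
  refine ⟨|C₀| + |C₁| * |A| + (|C₂| * |A| * |A| + |C₁| * |A|) + 1, by positivity,
    fun i t => ?_⟩
  have h0 : |H (c i t)| ≤ |C₀| := (hC₀ _ (hcK i t)).trans (le_abs_self _)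
  have h1 : ‖fderiv ℝ H (c i t)‖ ≤ |C₁| := (hC₁ _ (hcK i t)).trans (le_abs_self _)
  have h2 : ‖fderiv ℝ (fderiv ℝ H) (c i t)‖ ≤ |C₂| := (hC₂ _ (hcK i t)).trans (le_abs_self _)
  have a1 : ‖deriv (c i) t‖ ≤ |A| := (hA i t).trans (le_abs_self _)
  have a2 : ‖deriv (deriv (c i)) t‖ ≤ |A| := (hA' i t).trans (le_abs_self _)
  have b1 : |deriv (fun s => H (c i s)) t| ≤ |C₁| * |A| := by
    rw [(hd1 i t).deriv]
    exact ContinuousLinearMap.le_of_opNorm_le_of_le _ h1 a1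
  have b2 : |deriv (deriv fun s => H (c i s)) t| ≤ |C₂| * |A| * |A| + |C₁| * |A| := by
    rw [(hd2 i t).deriv]
    refine (abs_add_le _ _).trans (add_le_add ?_ ?_)
    · exact ContinuousLinearMap.le_of_opNorm_le_of_le _
        (ContinuousLinearMap.le_of_opNorm_le_of_le _ h2 a1) a1
    · exact ContinuousLinearMap.le_of_opNorm_le_of_le _ h1 a2
  linarith

/-- The normalized eigenfunction on the cap of aperture `b`, rescaled to `s ∈ (0, 1)`, as a
function of `(l, b, s)`; `w` is the normalization constant. -/
noncomputable def normalizedCapSeries (m : ℕ) (w : ℝ) (p : ℝ × ℝ × ℝ) : ℝ :=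
  (√(w * capEnergy m (p.1, p.2.1)))⁻¹ * capSeries (hyperCoeff m) (p.1, p.2.2 * p.2.1)

theorem normalizedCapSeries_contDiffOn (m : ℕ) {w : ℝ} (hw : 0 < w) (k : ℕ) :
    ContDiffOn ℝ k (normalizedCapSeries m w)
      {p | p.2.1 ∈ Set.Ioo 0 π ∧ p.2.2 * p.2.1 ∈ Set.Ioo (-π) π} := by
  have hE : ContDiffOn ℝ k (fun p : ℝ × ℝ × ℝ => w * capEnergy m (p.1, p.2.1))
      {p | p.2.1 ∈ Set.Ioo 0 π ∧ p.2.2 * p.2.1 ∈ Set.Ioo (-π) π} := by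
    refine contDiffOn_const.mul ((capEnergy_contDiffOn m k).comp
      (f := fun p : ℝ × ℝ × ℝ => (p.1, p.2.1)) (by fun_prop) fun p hp => ?_)
    exact ⟨by linarith [hp.1.1, Real.pi_pos], hp.1.2⟩
  have hpos : ∀ p ∈ {p : ℝ × ℝ × ℝ | p.2.1 ∈ Set.Ioo 0 π ∧ p.2.2 * p.2.1 ∈ Set.Ioo (-π) π},
      0 < w * capEnergy m (p.1, p.2.1) := fun p hp => mul_pos hw (capEnergy_pos m p.1 hp.1)
  refine ((hE.sqrt fun p hp => (hpos p hp).ne').inv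
    fun p hp => (Real.sqrt_pos.2 (hpos p hp)).ne').mul ?_
  exact ((admissibleCoeff_hyperCoeff m).capSeries_contDiffOn k).comp
    (f := fun p : ℝ × ℝ × ℝ => (p.1, p.2.2 * p.2.1)) (by fun_prop) fun p hp => hp.2

theorem eq_normalizedCapSeries {m : ℕ} {l b w : ℝ} (hb : b ∈ Set.Ioo 0 π) {φ : ℝ → ℝ}
    (hreg : ContDiffOn ℝ 2 φ (Set.Ioo 0 b)) (hcont : ContinuousOn φ (Set.Icc 0 b))
    (hpos : ∀ t ∈ Set.Ioo 0 b, 0 < φ t)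
    (hneu : Tendsto (fun t => deriv φ t) (nhdsWithin 0 (Set.Ioo 0 b)) (nhds 0))
    (hode : ∀ t ∈ Set.Ioo 0 b, deriv (fun s => Real.sin s ^ m * deriv φ s) t
      + l * (Real.sin t ^ m * φ t) = 0)
    (hnorm : w * ∫ t in (0 : ℝ)..b, Real.sin t ^ m * φ t ^ 2 = 1) {s : ℝ}
    (hs : s ∈ Set.Ioo (0 : ℝ) 1) :
    φ (s * b) = normalizedCapSeries m w (l, b, s) := by
  obtain ⟨k, hk, hφ⟩ := exists_eq_mul_capSeries hb hreg hcont hpos hneu hode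
  have hint : ∫ t in (0 : ℝ)..b, Real.sin t ^ m * φ t ^ 2 = k ^ 2 * capEnergy m (l, b) := by
    rw [← integral_sin_pow_mul_capSeries_sq m l hb, ← intervalIntegral.integral_const_mul]
    refine intervalIntegral.integral_congr_Ioo_of_le hb.1.le fun t ht => ?_
    simp only [hφ t ht]
    ring
  rw [hint] at hnorm
  have hsq : w * capEnergy m (l, b) = k⁻¹ ^ 2 := by
    field_simp
    linarith
  rw [hφ (s * b) ⟨mul_pos hs.1 hb.1, by nlinarith [hs.2, hb.1]⟩, normalizedCapSeries, hsq,
    Real.sqrt_sq (inv_pos.2 hk).le, inv_inv]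

theorem stmt1 (n : ℕ) (hn : 3 ≤ n) (β : ℝ → ℝ)
    (hβC2 : ContDiff ℝ 2 β)
    (hβbd : ∃ M : ℝ, ∀ τ : ℝ, |deriv β τ| ≤ M ∧ |deriv (deriv β) τ| ≤ M)
    (hβrange : ∃ m M : ℝ, 0 < m ∧ M < π ∧ ∀ τ : ℝ, m ≤ β τ ∧ β τ ≤ M)
    (lam : ℝ → ℝ)
    -- λ(τ) is the infimum of the weighted Rayleigh quotient
    (hlam : ∀ τ : ℝ, lam τ = sInf {R : ℝ | ∃ v : ℝ → ℝ,
        ContDiffOn ℝ 1 v (Set.Icc 0 (β τ)) ∧ v (β τ) = 0 ∧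
        (∃ t ∈ Set.Icc 0 (β τ), v t ≠ 0) ∧
        R = (∫ t in (0:ℝ)..(β τ), Real.sin t ^ (n - 2) * (deriv v t) ^ 2) /
            (∫ t in (0:ℝ)..(β τ), Real.sin t ^ (n - 2) * (v t) ^ 2)})
    (hlamC2 : ContDiff ℝ 2 lam)
    (hlambd : ∃ M : ℝ, ∀ τ : ℝ, |lam τ| + |deriv lam τ| + |deriv (deriv lam) τ| ≤ M)
    (hlampos : ∃ c > (0:ℝ), ∀ τ : ℝ, c ≤ lam τ)
    (φ₁ : ℝ → ℝ → ℝ)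
    (hφreg : ∀ τ : ℝ, ContDiffOn ℝ 2 (φ₁ τ) (Set.Ioo 0 (β τ)) ∧
        ContinuousOn (φ₁ τ) (Set.Icc 0 (β τ)))
    (hφpos : ∀ τ : ℝ, ∀ t ∈ Set.Ioo 0 (β τ), 0 < φ₁ τ t)
    (hφzero : ∀ τ : ℝ, φ₁ τ (β τ) = 0)
    (hφneu : ∀ τ : ℝ, Filter.Tendsto (fun t => deriv (φ₁ τ) t)
        (nhdsWithin 0 (Set.Ioo 0 (β τ))) (nhds 0))
    -- the singular Sturm–Liouville equation
    (hφode : ∀ τ : ℝ, ∀ t ∈ Set.Ioo 0 (β τ),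
        deriv (fun s => Real.sin s ^ (n - 2) * deriv (φ₁ τ) s) t
          + lam τ * (Real.sin t ^ (n - 2) * φ₁ τ t) = 0)
    -- normalization: ω_{n-2} ∫ sin^{n-2} φ₁² = 1, with ω_{n-2} the total surface
    -- (Hausdorff) measure of the unit sphere S^{n-2} ⊂ ℝ^{n-1}
    (hφnorm : ∀ τ : ℝ,
        (MeasureTheory.Measure.hausdorffMeasure ((n:ℝ) - 2)
            (Metric.sphere (0 : EuclideanSpace ℝ (Fin (n - 1))) 1)).toReal *
          ∫ t in (0:ℝ)..(β τ), Real.sin t ^ (n - 2) * (φ₁ τ t) ^ 2 = 1) :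
    -- ψ(τ,s) = φ₁(τ, s·β(τ)) is twice differentiable in τ
    (∀ s ∈ Set.Ioo (0:ℝ) 1, ∀ τ : ℝ,
        DifferentiableAt ℝ (fun τ' => φ₁ τ' (s * β τ')) τ ∧
        DifferentiableAt ℝ (deriv fun τ' => φ₁ τ' (s * β τ')) τ) ∧
    -- with a uniform bound on ψ and its first two τ-derivatives
    ∃ C > (0:ℝ), ∀ τ : ℝ, ∀ s ∈ Set.Ioo (0:ℝ) 1,
        |φ₁ τ (s * β τ)| + |deriv (fun τ' => φ₁ τ' (s * β τ')) τ|
          + |deriv (deriv fun τ' => φ₁ τ' (s * β τ')) τ| ≤ C := by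
  obtain ⟨bmin, bmax, hbmin, hbmax, hβ⟩ := hβrange
  obtain ⟨Mβ, hMβ⟩ := hβbd
  obtain ⟨Ml, hMl⟩ := hlambd
  set w : ℝ := (MeasureTheory.Measure.hausdorffMeasure ((n:ℝ) - 2)
    (Metric.sphere (0 : EuclideanSpace ℝ (Fin (n - 1))) 1)).toReal
  have hw0 : 0 ≤ w := ENNReal.toReal_nonneg
  have hwpos : 0 < w := hw0.lt_of_ne fun h => by simpa [← h] using hφnorm 0
  have hβ' : ∀ τ, β τ ∈ Set.Ioo 0 π := fun τ =>
    ⟨hbmin.trans_le (hβ τ).1, (hβ τ).2.trans_lt hbmax⟩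
  have hψ : ∀ s ∈ Set.Ioo (0 : ℝ) 1, (fun τ => φ₁ τ (s * β τ)) =
      fun τ => normalizedCapSeries (n - 2) w (lam τ, β τ, s) := fun s hs => funext fun τ =>
    eq_normalizedCapSeries (hβ' τ) (hφreg τ).1 (hφreg τ).2 (hφpos τ) (hφneu τ)
      (hφode τ) (hφnorm τ) hs
  have hd1 : ∀ s τ, HasDerivAt (fun τ => (lam τ, β τ, s)) (deriv lam τ, deriv β τ, (0 : ℝ)) τ :=
    fun s τ => (hlamC2.differentiable (by norm_num) τ).hasDerivAt.prodMk
      ((hβC2.differentiable (by norm_num) τ).hasDerivAt.prodMk (hasDerivAt_const τ s))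
  have hd1' : ∀ s : ℝ, (deriv fun τ => (lam τ, β τ, s)) = fun τ => (deriv lam τ, deriv β τ, 0) :=
    fun s => funext fun τ => (hd1 s τ).deriv
  have hd2 : ∀ (s τ : ℝ), deriv (deriv fun τ => (lam τ, β τ, s)) τ =
      (deriv (deriv lam) τ, deriv (deriv β) τ, 0) := fun s τ => by
    rw [hd1' s]
    exact ((hlamC2.differentiable_deriv_two τ).hasDerivAt.prodMk
      ((hβC2.differentiable_deriv_two τ).hasDerivAt.prodMk (hasDerivAt_const τ 0))).deriv
  have hU : IsOpen {p : ℝ × ℝ × ℝ | p.2.1 ∈ Set.Ioo 0 π ∧ p.2.2 * p.2.1 ∈ Set.Ioo (-π) π} :=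
    (isOpen_Ioo.preimage (continuous_fst.comp continuous_snd)).inter
      (isOpen_Ioo.preimage (f := fun p : ℝ × ℝ × ℝ => p.2.2 * p.2.1) (by fun_prop))
  have hKU : (Set.Icc (-Ml) Ml ×ˢ Set.Icc bmin bmax ×ˢ Set.Icc 0 1 : Set (ℝ × ℝ × ℝ)) ⊆
      {p | p.2.1 ∈ Set.Ioo 0 π ∧ p.2.2 * p.2.1 ∈ Set.Ioo (-π) π} := by
    rintro ⟨l, b, s⟩ ⟨-, hb, hs⟩
    have hb0 : 0 < b := hbmin.trans_le hb.1
    have hbπ : b < π := hb.2.trans_lt hbmax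
    exact ⟨⟨hb0, hbπ⟩, by nlinarith [Real.pi_pos, mul_nonneg hs.1 hb0.le],
      by nlinarith [mul_nonneg (sub_nonneg.2 hs.2) hb0.le]⟩
  have hcK : ∀ (s : Set.Ioo (0 : ℝ) 1) (τ : ℝ), (lam τ, β τ, (s : ℝ)) ∈
      (Set.Icc (-Ml) Ml ×ˢ Set.Icc bmin bmax ×ˢ Set.Icc 0 1 : Set (ℝ × ℝ × ℝ)) := by
    intro s τ
    have h := hMl τ
    exact ⟨abs_le.1 (by linarith [abs_nonneg (deriv lam τ), abs_nonneg (deriv (deriv lam) τ)]),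
      hβ τ, Set.Ioo_subset_Icc_self s.2⟩
  have hA : ∀ (s : Set.Ioo (0 : ℝ) 1) (τ : ℝ),
      ‖deriv (fun τ => (lam τ, β τ, (s : ℝ))) τ‖ ≤ max Ml Mβ := by
    intro s τ
    have h := hMl τ
    have h1 : |deriv lam τ| ≤ Ml := by
      linarith [abs_nonneg (lam τ), abs_nonneg (deriv (deriv lam) τ)]
    rw [hd1' s]
    simp only [Prod.norm_def, Real.norm_eq_abs, abs_zero]
    exact max_le (h1.trans (le_max_left _ _)) (max_le ((hMβ τ).1.trans (le_max_right _ _))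
      (((abs_nonneg _).trans (hMβ τ).1).trans (le_max_right _ _)))
  have hA' : ∀ (s : Set.Ioo (0 : ℝ) 1) (τ : ℝ),
      ‖deriv (deriv fun τ => (lam τ, β τ, (s : ℝ))) τ‖ ≤ max Ml Mβ := by
    intro s τ
    have h := hMl τ
    have h1 : |deriv (deriv lam) τ| ≤ Ml := by
      linarith [abs_nonneg (lam τ), abs_nonneg (deriv lam τ)]
    rw [hd2 s]
    simp only [Prod.norm_def, Real.norm_eq_abs, abs_zero]
    exact max_le (h1.trans (le_max_left _ _)) (max_le ((hMβ τ).2.trans (le_max_right _ _))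
      (((abs_nonneg _).trans (hMβ τ).2).trans (le_max_right _ _)))
  obtain ⟨hdiff, C, hC, hbound⟩ := exists_bound_deriv_comp
    hU (normalizedCapSeries_contDiffOn (n - 2) hwpos 2)
    (isCompact_Icc.prod (isCompact_Icc.prod isCompact_Icc)) hKU
    (fun s => hlamC2.prodMk (hβC2.prodMk contDiff_const)) hcK hA hA'
  refine ⟨fun s hs τ => ?_, C, hC, fun τ s hs => ?_⟩
  · rw [hψ s hs]
    exact hdiff ⟨s, hs⟩ τ
  · rw [hψ s hs, congrFun (hψ s hs) τ]
    exact hbound ⟨s, hs⟩ τ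
end

section
/- Let n ≥ 3 and β ∈ (0,π). Then there exists a constant C > 0, depending only on n and β, such that for every v ∈ C¹([0,β]) with v(β) = 0 one has ∫₀^β v(t)² sin^{n−3}(t) dt ≤ C ∫₀^β sin^{n−2}(t) v′(t)² dt. -/
open Real MeasureTheory

/-- The pointwise inequality behind the weighted Hardy–Poincaré inequality: `x` and `y` stand for
the values of the function and of its derivative, `s` for `sin t`, and `a` for
`(1 + cos t) ^ (m + 1)`, which lies between `c` and `b`. -/
lemma hardy_pointwise_bound (m : ℕ) {x y s a b c : ℝ} (hs : 0 ≤ s) (hs1 : s ≤ 1) (hc : 0 < c)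
    (hca : c ≤ a) (hab : a ≤ b) :
    x ^ 2 * s ^ m ≤ 4 * b / c * (s ^ (m + 1) * y ^ 2) +
      2 * b * (2 * x * y * (s ^ (m + 1) / a) + x ^ 2 * ((m + 1) * s ^ m / a)) := by
  have ha : 0 < a := hc.trans_le hca
  have hb : 0 < b := ha.trans_le hab
  have h1 : 1 ≤ b / a := (one_le_div ha).2 hab
  have h2 : b / a ≤ b / c := div_le_div_of_nonneg_left hb.le hc hca
  have h3 : x ^ 2 / 2 - 2 * (s * y ^ 2) ≤ 2 * x * y * s + (m + 1) * x ^ 2 := by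
    have : 0 ≤ (m : ℝ) * x ^ 2 := by positivity
    have : s ^ 2 * y ^ 2 ≤ s * y ^ 2 := by
      gcongr
      nlinarith
    nlinarith [sq_nonneg (x + 2 * (s * y))]
  have h4 : x ^ 2 ≤ 4 * (b / c) * (s * y ^ 2) +
      2 * (b / a) * (2 * x * y * s + (m + 1) * x ^ 2) := by
    have e1 := mul_le_mul_of_nonneg_left h3 (by positivity : 0 ≤ 2 * (b / a))
    have e2 := mul_le_mul_of_nonneg_right h2 (by positivity : 0 ≤ s * y ^ 2)
    have e3 := mul_le_mul_of_nonneg_right h1 (sq_nonneg x)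
    linarith
  calc x ^ 2 * s ^ m ≤ (4 * (b / c) * (s * y ^ 2) +
        2 * (b / a) * (2 * x * y * s + (m + 1) * x ^ 2)) * s ^ m := by gcongr
    _ = _ := by ring

/-- The derivative of `tan (t / 2) ^ (m + 1)`, written in terms of `sin t` and `cos t`. -/
lemma hasDerivAt_sin_pow_div_one_add_cos_pow (m : ℕ) {t : ℝ} (ht : 0 < 1 + cos t) :
    HasDerivAt (fun u => sin u ^ (m + 1) / (1 + cos u) ^ (m + 1))
      ((m + 1) * sin t ^ m / (1 + cos t) ^ (m + 1)) t := by
  have h := (((hasDerivAt_sin t).div ((hasDerivAt_cos t).const_add 1) ht.ne').pow (m + 1))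
  have hfun : (fun u => sin u ^ (m + 1) / (1 + cos u) ^ (m + 1)) =
      (sin / fun u => 1 + cos u) ^ (m + 1) := by
    ext u
    simp [div_pow]
  rw [hfun]
  refine h.congr_deriv ?_
  have hne := ht.ne'
  have e : cos t * (1 + cos t) - sin t * -sin t = 1 + cos t := by
    nlinarith [sin_sq_add_cos_sq t]
  simp only [Pi.div_apply, e, Nat.add_sub_cancel, div_pow]
  push_cast
  field_simp
  ring

theorem stmt3 (n : ℕ) (hn : 3 ≤ n) (β : ℝ) (hβ : β ∈ Set.Ioo 0 π) :
    ∃ C > (0:ℝ), ∀ v : ℝ → ℝ, ContDiffOn ℝ 1 v (Set.Icc 0 β) → v β = 0 →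
      (∫ t in (0:ℝ)..β, (v t) ^ 2 * Real.sin t ^ (n - 3)) ≤
        C * ∫ t in (0:ℝ)..β, Real.sin t ^ (n - 2) * (deriv v t) ^ 2 := by
  obtain ⟨m, rfl⟩ := Nat.exists_eq_add_of_le' hn
  obtain ⟨hβ0, hβπ⟩ := hβ
  have hcosβ : 0 < 1 + cos β := by
    have := cos_lt_cos_of_nonneg_of_le_pi hβ0.le le_rfl hβπ
    rw [cos_pi] at this
    linarith
  have hcos : ∀ t ∈ Set.Icc 0 β, 1 + cos β ≤ 1 + cos t := fun t ht => by
    gcongr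
    exact cos_le_cos_of_nonneg_of_le_pi ht.1 hβπ.le ht.2
  refine ⟨4 * 2 ^ (m + 1) / (1 + cos β) ^ (m + 1), by positivity, fun v hv hvβ => ?_⟩
  rw [show m + 3 - 3 = m by omega, show m + 3 - 2 = m + 1 by omega]
  set w := derivWithin v (Set.Icc 0 β)
  have hw : ContinuousOn w (Set.Icc 0 β) :=
    hv.continuousOn_derivWithin (uniqueDiffOn_Icc hβ0) le_rfl
  have hvc : ContinuousOn v (Set.Icc 0 β) := hv.continuousOn
  have hderiv : ∀ t ∈ Set.Ioo 0 β, HasDerivAt v (w t) t := fun t ht =>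
    ((hv.differentiableOn one_ne_zero t ⟨ht.1.le, ht.2.le⟩).hasDerivWithinAt).hasDerivAt
      (Icc_mem_nhds ht.1 ht.2)
  have hint : ∫ t in (0:ℝ)..β, sin t ^ (m + 1) * (deriv v t) ^ 2 =
      ∫ t in (0:ℝ)..β, sin t ^ (m + 1) * (w t) ^ 2 := by
    simp only [intervalIntegral.integral_of_le hβ0.le, integral_Ioc_eq_integral_Ioo]
    exact setIntegral_congr_fun measurableSet_Ioo fun t ht => by simp only [(hderiv t ht).deriv]
  rw [hint]
  have hne : ∀ t ∈ Set.Icc 0 β, (1 + cos t) ^ (m + 1) ≠ 0 := fun t ht =>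
    (pow_pos (hcosβ.trans_le (hcos t ht)) _).ne'
  have hφ : ContinuousOn (fun t => sin t ^ (m + 1) / (1 + cos t) ^ (m + 1)) (Set.Icc 0 β) :=
    ContinuousOn.div (by fun_prop) (by fun_prop) hne
  have hφ' : ContinuousOn (fun t => (m + 1) * sin t ^ m / (1 + cos t) ^ (m + 1)) (Set.Icc 0 β) :=
    ContinuousOn.div (by fun_prop) (by fun_prop) hne
  set G : ℝ → ℝ := fun t => 2 * v t * w t * (sin t ^ (m + 1) / (1 + cos t) ^ (m + 1)) +
    v t ^ 2 * ((m + 1) * sin t ^ m / (1 + cos t) ^ (m + 1))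
  have hG : IntervalIntegrable G volume 0 β :=
    ContinuousOn.intervalIntegrable_of_Icc hβ0.le (by fun_prop)
  have hW : IntervalIntegrable (fun t => sin t ^ (m + 1) * w t ^ 2) volume 0 β :=
    ContinuousOn.intervalIntegrable_of_Icc hβ0.le (by fun_prop)
  have hG0 : ∫ t in (0:ℝ)..β, G t = 0 := by
    rw [intervalIntegral.integral_eq_sub_of_hasDerivAt_of_le hβ0.le
      (f := fun t => v t ^ 2 * (sin t ^ (m + 1) / (1 + cos t) ^ (m + 1))) (by fun_prop) ?_ hG]
    · simp [hvβ]
    · intro t ht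
      have hpos := hcosβ.trans_le (hcos t ⟨ht.1.le, ht.2.le⟩)
      exact (((hderiv t ht).pow 2).mul
        (hasDerivAt_sin_pow_div_one_add_cos_pow m hpos)).congr_deriv (by simp [G])
  calc ∫ t in (0:ℝ)..β, v t ^ 2 * sin t ^ m
      ≤ ∫ t in (0:ℝ)..β, (4 * 2 ^ (m + 1) / (1 + cos β) ^ (m + 1) * (sin t ^ (m + 1) * w t ^ 2) +
          2 * 2 ^ (m + 1) * G t) := by
        refine intervalIntegral.integral_mono_on hβ0.le
          (ContinuousOn.intervalIntegrable_of_Icc hβ0.le (by fun_prop))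
          ((hW.const_mul _).add (hG.const_mul _)) fun t ht => ?_
        have hct := hcos t ht
        refine hardy_pointwise_bound m (sin_nonneg_of_nonneg_of_le_pi ht.1 (ht.2.trans hβπ.le))
          (sin_le_one t) (by positivity) (by gcongr) ?_
        exact pow_le_pow_left₀ (hcosβ.le.trans hct) (by linarith [cos_le_one t]) _
    _ = _ := by
        rw [intervalIntegral.integral_add (hW.const_mul _) (hG.const_mul _),
          intervalIntegral.integral_const_mul, intervalIntegral.integral_const_mul, hG0]
        ring
end

section
/- Let 0 < s ≤ ∞, q ≥ 2, and let A, B : (0,s) → [0,∞) be measurable functions such that 1/A is integrable on (r,s) and B is integrable on (0,r) for every r ∈ (0,s). Suppose C > 0 is a constant such that (∫₀^s B(t) |u(t)|^q dt)^{1/q} ≤ C (∫₀^s A(t) |u′(t)|² dt)^{1/2} for every u ∈ C¹([0,s]) with u(s) = 0 (or, in case s = ∞, every C¹ function u vanishing near infinity). Then K ≤ C, where K = sup_{r ∈ (0,s)} (∫₀^r B(t) dt)^{1/q} (∫_r^s A(t)^{−1} dt)^{1/2}. -/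
open Real MeasureTheory Filter ENNReal

/-- An integrable function is an almost everywhere limit of continuous functions. -/
lemma MeasureTheory.Integrable.exists_seq_continuous_tendsto_ae {μ : Measure ℝ}
    [μ.WeaklyRegular] {f : ℝ → ℝ} (hf : Integrable f μ) :
    ∃ ψ : ℕ → ℝ → ℝ, (∀ n, Continuous (ψ n)) ∧
      ∀ᵐ x ∂μ, Tendsto (fun n => ψ n x) atTop (nhds (f x)) := by
  have key : ∀ n : ℕ, ∃ g : BoundedContinuousFunction ℝ ℝ,
      eLpNorm (f - (g : ℝ → ℝ)) 1 μ ≤ ENNReal.ofReal (1 / ((n : ℝ) + 1)) ∧ MemLp g 1 μ := fun n =>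
    (memLp_one_iff_integrable.2 hf).exists_boundedContinuous_eLpNorm_sub_le
      ENNReal.one_ne_top (ENNReal.ofReal_pos.2 (by positivity)).ne'
  choose g hg hgm using key
  have hlim : Tendsto (fun n => eLpNorm ((g n : ℝ → ℝ) - f) 1 μ) atTop (nhds 0) := by
    have h0 : Tendsto (fun n : ℕ => ENNReal.ofReal (1 / ((n : ℝ) + 1))) atTop (nhds 0) := by
      simpa using (ENNReal.tendsto_ofReal (tendsto_one_div_add_atTop_nhds_zero_nat (𝕜 := ℝ)))
    refine tendsto_of_tendsto_of_tendsto_of_le_of_le tendsto_const_nhds h0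
      (fun n => zero_le) (fun n => ?_)
    rw [eLpNorm_sub_comm]
    exact hg n
  obtain ⟨ns, -, hns⟩ := (tendstoInMeasure_of_tendsto_eLpNorm one_ne_zero
    (fun n => (hgm n).1) hf.1 hlim).exists_seq_tendsto_ae
  exact ⟨fun n => g (ns n), fun n => (g (ns n)).continuous, hns⟩

/-- The converse Cauchy–Schwarz bound: if `b ∫ φ ≤ (∫ A φ²)^{1/2}` for all nonnegative continuous
`φ` supported in the interval, then `b (∫ A⁻¹)^{1/2} ≤ 1`. Nonintegrable `A φ²` is assigned
integral zero, so the hypothesis forces integrability for `φ ≠ 0`. -/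
lemma mul_integral_inv_rpow_le_one {A : ℝ → ℝ} {r c b : ℝ} (hrc : r < c) (hb : 0 < b)
    (hAm : Measurable A) (hA : ∀ t ∈ Set.Ioo r c, 0 ≤ A t)
    (hAint : IntegrableOn (fun t => (A t)⁻¹) (Set.Ioo r c))
    (H : ∀ φ : ℝ → ℝ, Continuous φ → (∀ t, 0 ≤ φ t) → (∀ t ∉ Set.Ioo r c, φ t = 0) →
      b * ∫ t in Set.Ioo r c, φ t ≤ (∫ t in Set.Ioo r c, A t * φ t ^ 2) ^ ((1 : ℝ) / 2)) :
    b * (∫ t in Set.Ioo r c, (A t)⁻¹) ^ ((1 : ℝ) / 2) ≤ 1 := by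
  set h : ℝ → ℝ := fun t => max 0 (min (t - r) (c - t)) with hh
  have hhc : Continuous h := by fun_prop
  have hh0 : ∀ t, 0 ≤ h t := fun t => le_max_left _ _
  have hhpos : ∀ t ∈ Set.Ioo r c, 0 < h t := fun t ht =>
    lt_max_of_lt_right (lt_min (sub_pos.2 ht.1) (sub_pos.2 ht.2))
  have hhz : ∀ t ∉ Set.Ioo r c, h t = 0 := by
    intro t ht
    refine max_eq_left ?_
    by_contra! hlt
    have := lt_min_iff.1 hlt
    exact ht ⟨sub_pos.1 this.1, sub_pos.1 this.2⟩
  have hhint : IntegrableOn h (Set.Ioo r c) :=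
    (hhc.continuousOn.integrableOn_Icc (a := r) (b := c)).mono_set Set.Ioo_subset_Icc_self
  have hAh : IntegrableOn (fun t => A t * h t ^ 2) (Set.Ioo r c) := by
    by_contra hn
    have h1 := H h hhc hh0 hhz
    rw [integral_undef hn, Real.zero_rpow (by norm_num)] at h1
    have h2 : 0 < ∫ t in Set.Ioo r c, h t := by
      rw [← integral_Ioc_eq_integral_Ioo, ← intervalIntegral.integral_of_le hrc.le]
      exact intervalIntegral.intervalIntegral_pos_of_pos_on
        (hhc.intervalIntegrable _ _) hhpos hrc
    exact absurd h1 (not_le.2 (mul_pos hb h2))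
  set G : ℕ → ℝ → ℝ := fun m t => max 0 (min (A t)⁻¹ (m * h t)) with hG
  have hG0 : ∀ m t, 0 ≤ G m t := fun m t => le_max_left _ _
  have hGA : ∀ m, ∀ t ∈ Set.Ioo r c, G m t ≤ (A t)⁻¹ := fun m t ht =>
    max_le (inv_nonneg.2 (hA t ht)) (min_le_left _ _)
  have hGm : ∀ m, Measurable (G m) := fun m => by
    have := hhc.measurable
    fun_prop
  have hGint : ∀ m, IntegrableOn (G m) (Set.Ioo r c) := fun m => by
    refine Integrable.mono' hAint (hGm m).aestronglyMeasurable ?_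
    filter_upwards [ae_restrict_mem measurableSet_Ioo] with t ht
    rw [Real.norm_of_nonneg (hG0 m t)]
    exact hGA m t ht
  obtain ⟨ψ, hψc, hψ⟩ := hAint.exists_seq_continuous_tendsto_ae
  have hstep : ∀ m, b * ∫ t in Set.Ioo r c, G m t ≤
      (∫ t in Set.Ioo r c, A t * G m t ^ 2) ^ ((1 : ℝ) / 2) := by
    intro m
    set φ : ℕ → ℝ → ℝ := fun n t => max 0 (min (ψ n t) (m * h t)) with hφ
    have hφc : ∀ n, Continuous (φ n) := fun n => by
      have := hψc n
      fun_prop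
    have hφ0 : ∀ n t, 0 ≤ φ n t := fun n t => le_max_left _ _
    have hφh : ∀ n t, φ n t ≤ m * h t := fun n t =>
      max_le (mul_nonneg m.cast_nonneg (hh0 t)) (min_le_right _ _)
    have hφz : ∀ n, ∀ t ∉ Set.Ioo r c, φ n t = 0 := fun n t ht =>
      le_antisymm (by simpa [hhz t ht] using hφh n t) (hφ0 n t)
    have hφl : ∀ᵐ t ∂volume.restrict (Set.Ioo r c),
        Tendsto (fun n => φ n t) atTop (nhds (G m t)) := by
      filter_upwards [hψ] with t ht
      exact tendsto_const_nhds.max (ht.min tendsto_const_nhds)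
    have l1 : Tendsto (fun n => ∫ t in Set.Ioo r c, φ n t) atTop
        (nhds (∫ t in Set.Ioo r c, G m t)) := by
      refine tendsto_integral_of_dominated_convergence (fun t => m * h t)
        (fun n => (hφc n).aestronglyMeasurable) (hhint.const_mul _) (fun n => ?_) hφl
      refine ae_of_all _ fun t => ?_
      rw [Real.norm_of_nonneg (hφ0 n t)]
      exact hφh n t
    have l2 : Tendsto (fun n => ∫ t in Set.Ioo r c, A t * φ n t ^ 2) atTop
        (nhds (∫ t in Set.Ioo r c, A t * G m t ^ 2)) := by
      refine tendsto_integral_of_dominated_convergence (fun t => (m : ℝ) ^ 2 * (A t * h t ^ 2))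
        (fun n => (hAm.mul ((hφc n).measurable.pow_const 2)).aestronglyMeasurable)
        (hAh.const_mul _) (fun n => ?_) ?_
      · filter_upwards [ae_restrict_mem measurableSet_Ioo] with t ht
        rw [Real.norm_of_nonneg (mul_nonneg (hA t ht) (sq_nonneg _))]
        calc A t * φ n t ^ 2 ≤ A t * (m * h t) ^ 2 :=
              mul_le_mul_of_nonneg_left (pow_le_pow_left₀ (hφ0 n t) (hφh n t) 2) (hA t ht)
          _ = (m : ℝ) ^ 2 * (A t * h t ^ 2) := by ring
      · filter_upwards [hφl] with t ht
        exact (ht.pow 2).const_mul _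
    exact le_of_tendsto_of_tendsto' (l1.const_mul b)
      (l2.rpow_const (Or.inr (by norm_num))) fun n => H (φ n) (hφc n) (hφ0 n) (hφz n)
  have hbound : ∀ m, b * (∫ t in Set.Ioo r c, G m t) ^ ((1 : ℝ) / 2) ≤ 1 := by
    intro m
    have hle : ∀ t ∈ Set.Ioo r c, A t * G m t ^ 2 ≤ G m t := by
      intro t ht
      have h1 : A t * G m t ≤ 1 :=
        (mul_le_mul_of_nonneg_left (hGA m t ht) (hA t ht)).trans (mul_inv_le_one)
      calc A t * G m t ^ 2 = (A t * G m t) * G m t := by ring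
        _ ≤ 1 * G m t := mul_le_mul_of_nonneg_right h1 (hG0 m t)
        _ = G m t := one_mul _
    have hint : ∫ t in Set.Ioo r c, A t * G m t ^ 2 ≤ ∫ t in Set.Ioo r c, G m t := by
      refine integral_mono_of_nonneg ?_ (hGint m) ?_
      · filter_upwards [ae_restrict_mem measurableSet_Ioo] with t ht
        exact mul_nonneg (hA t ht) (sq_nonneg _)
      · filter_upwards [ae_restrict_mem measurableSet_Ioo] with t ht
        exact hle t ht
    have hI0 : 0 ≤ ∫ t in Set.Ioo r c, A t * G m t ^ 2 :=
      setIntegral_nonneg measurableSet_Ioo fun t ht => mul_nonneg (hA t ht) (sq_nonneg _)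
    have h1 := (hstep m).trans (Real.rpow_le_rpow hI0 hint (by norm_num))
    have hx0 : 0 ≤ ∫ t in Set.Ioo r c, G m t := integral_nonneg (hG0 m)
    rw [← Real.sqrt_eq_rpow] at h1 ⊢
    set x := ∫ t in Set.Ioo r c, G m t
    rcases hx0.eq_or_lt with hx | hx
    · simp [← hx]
    · have hs := Real.sqrt_pos.2 hx
      refine le_of_mul_le_mul_right ?_ hs
      rwa [mul_assoc, Real.mul_self_sqrt hx0, one_mul]
  have hlim : Tendsto (fun m => ∫ t in Set.Ioo r c, G m t) atTop
      (nhds (∫ t in Set.Ioo r c, (A t)⁻¹)) := by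
    refine tendsto_integral_of_dominated_convergence (fun t => (A t)⁻¹)
      (fun m => (hGm m).aestronglyMeasurable) hAint (fun m => ?_) ?_
    · filter_upwards [ae_restrict_mem measurableSet_Ioo] with t ht
      rw [Real.norm_of_nonneg (hG0 m t)]
      exact hGA m t ht
    · filter_upwards [ae_restrict_mem measurableSet_Ioo] with t ht
      refine tendsto_const_nhds.congr' ?_
      obtain ⟨N, hN⟩ := exists_nat_ge ((A t)⁻¹ / h t)
      filter_upwards [eventually_ge_atTop N] with m hm
      have : (A t)⁻¹ ≤ m * h t := (div_le_iff₀ (hhpos t ht)).1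
        (hN.trans (Nat.cast_le.2 hm))
      simp only [hG]
      rw [min_eq_left this, max_eq_right (inv_nonneg.2 (hA t ht))]
  exact le_of_tendsto' ((hlim.rpow_const (Or.inr (by norm_num))).const_mul b) hbound

/-- The primitive `u(t) = ∫_t^c φ` as a test function: the left-hand side of the weighted Sobolev
inequality dominates `(∫₀^r B)^{1/q} ∫ φ` when `φ ≥ 0` is supported in `(r, c)`. -/
lemma rpow_mul_integral_le_of_primitive {B φ : ℝ → ℝ} {S : Set ℝ} {r c q : ℝ}
    (hrc : r < c) (hq : 0 < q) (hS : MeasurableSet S) (hcS : Set.Ioo 0 c ⊆ S)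
    (hS0 : ∀ t ∈ S, 0 < t) (hB : ∀ t ∈ S, 0 ≤ B t) (hBint : IntegrableOn B (Set.Ioo 0 c))
    (hφ : Continuous φ) (hφ0 : ∀ t, 0 ≤ φ t) (hφz : ∀ t ∉ Set.Ioo r c, φ t = 0) :
    (∫ t in Set.Ioo 0 r, B t) ^ (1 / q) * ∫ t in Set.Ioo r c, φ t ≤
      (∫ t in S, B t * |∫ x in t..c, φ x| ^ q) ^ (1 / q) := by
  set u : ℝ → ℝ := fun t => ∫ x in t..c, φ x with hu
  set I := ∫ t in Set.Ioo r c, φ t with hI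
  have hI0 : 0 ≤ I := integral_nonneg hφ0
  have hIr : ∫ x in r..c, φ x = I := by
    rw [intervalIntegral.integral_of_le hrc.le, integral_Ioc_eq_integral_Ioo]
  have huc : Continuous u := by
    have : u = fun t => -∫ x in c..t, φ x := by
      ext t
      exact intervalIntegral.integral_symm _ _
    rw [this]
    exact (intervalIntegral.continuous_primitive (fun a b => hφ.intervalIntegrable a b) c).neg
  have huz : ∀ t, c ≤ t → u t = 0 := by
    intro t ht
    refine (intervalIntegral.integral_congr (g := fun _ => 0) fun x hx => ?_).trans (by simp)
    rw [Set.uIcc_of_ge ht] at hx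
    exact hφz x fun h => absurd h.2 (not_lt.2 hx.1)
  have hur : ∀ t ≤ r, u t = I := by
    intro t ht
    have : ∫ x in t..r, φ x = 0 := by
      refine (intervalIntegral.integral_congr (g := fun _ => 0) fun x hx => ?_).trans (by simp)
      rw [Set.uIcc_of_le ht] at hx
      exact hφz x fun h => absurd h.1 (not_lt.2 hx.2)
    rw [hu, ← hIr]
    simp only
    rw [← intervalIntegral.integral_add_adjacent_intervals (hφ.intervalIntegrable t r)
      (hφ.intervalIntegrable r c), this, zero_add]
  have hwc : Continuous fun t => |u t| ^ q :=
    huc.abs.rpow_const fun _ => Or.inr hq.le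
  have hint0 : IntegrableOn (fun t => B t * |u t| ^ q) (Set.Ioo 0 c) := by
    obtain ⟨M, hM⟩ := (isCompact_Icc (a := (0 : ℝ)) (b := c)).exists_bound_of_continuousOn
      hwc.continuousOn
    refine Integrable.mul_bdd hBint (c := M) hwc.aestronglyMeasurable ?_
    filter_upwards [ae_restrict_mem measurableSet_Ioo] with t ht
    exact hM t (Set.Ioo_subset_Icc_self ht)
  have hint : IntegrableOn (fun t => B t * |u t| ^ q) S := by
    refine hint0.of_forall_sdiff_eq_zero hS fun t ht => ?_
    have : c ≤ t := by
      by_contra! h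
      exact ht.2 ⟨hS0 t ht.1, h⟩
    simp [huz t this, Real.zero_rpow hq.ne']
  have hrS : Set.Ioo 0 r ⊆ S := (Set.Ioo_subset_Ioo_right hrc.le).trans hcS
  have hle : (∫ t in Set.Ioo 0 r, B t) * I ^ q ≤ ∫ t in S, B t * |u t| ^ q := by
    rw [← integral_mul_const]
    calc ∫ t in Set.Ioo 0 r, B t * I ^ q = ∫ t in Set.Ioo 0 r, B t * |u t| ^ q :=
          setIntegral_congr_fun measurableSet_Ioo fun t ht => by
            simp only [hur t ht.2.le, abs_of_nonneg hI0]
      _ ≤ ∫ t in S, B t * |u t| ^ q := by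
          refine setIntegral_mono_set hint ?_ hrS.eventuallyLE
          filter_upwards [ae_restrict_mem hS] with t ht
          exact mul_nonneg (hB t ht) (by positivity)
  have hB0 : 0 ≤ ∫ t in Set.Ioo 0 r, B t :=
    setIntegral_nonneg measurableSet_Ioo fun t ht => hB t (hrS ht)
  calc (∫ t in Set.Ioo 0 r, B t) ^ (1 / q) * I
      = ((∫ t in Set.Ioo 0 r, B t) * I ^ q) ^ (1 / q) := by
        rw [Real.mul_rpow hB0 (by positivity), ← Real.rpow_mul hI0, mul_one_div_cancel hq.ne',
          Real.rpow_one]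
    _ ≤ _ := Real.rpow_le_rpow (by positivity) hle (by positivity)

/-- Maz'ya's one-dimensional weighted Sobolev inequality (necessity direction),
on the interval `(0,s)` with `0 < s ≤ ∞`: if the inequality holds with constant `C`,
then `K ≤ C` where `K = sup_r (∫₀^r B)^{1/q} (∫_r^s A⁻¹)^{1/2}`. -/
theorem stmt5 (s : ℝ≥0∞) (hs : 0 < s) (q : ℝ) (hq : 2 ≤ q) (A B : ℝ → ℝ)
    (hAnn : ∀ t ∈ {t : ℝ | 0 < t ∧ ENNReal.ofReal t < s}, 0 ≤ A t)
    (hBnn : ∀ t ∈ {t : ℝ | 0 < t ∧ ENNReal.ofReal t < s}, 0 ≤ B t)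
    (hAm : Measurable A) (hBm : Measurable B)
    (hAint : ∀ r ∈ {t : ℝ | 0 < t ∧ ENNReal.ofReal t < s},
        MeasureTheory.IntegrableOn (fun t => (A t)⁻¹)
          {t : ℝ | r < t ∧ ENNReal.ofReal t < s})
    (hBint : ∀ r ∈ {t : ℝ | 0 < t ∧ ENNReal.ofReal t < s},
        MeasureTheory.IntegrableOn B (Set.Ioo 0 r))
    (C : ℝ) (hC : 0 < C)
    -- the weighted Sobolev inequality holds with constant C for every admissible u
    (hineq : ∀ u : ℝ → ℝ,
      ContDiffOn ℝ 1 u {t : ℝ | 0 ≤ t ∧ ENNReal.ofReal t ≤ s} →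
      (s ≠ ⊤ → u s.toReal = 0) → (s = ⊤ → ∃ T : ℝ, ∀ t ≥ T, u t = 0) →
      (∫ t in {t : ℝ | 0 < t ∧ ENNReal.ofReal t < s}, B t * |u t| ^ q) ^ (1 / q) ≤
        C * (∫ t in {t : ℝ | 0 < t ∧ ENNReal.ofReal t < s}, A t * (deriv u t) ^ 2)
              ^ ((1:ℝ) / 2)) :
    sSup {k : ℝ | ∃ r ∈ {t : ℝ | 0 < t ∧ ENNReal.ofReal t < s},
        k = (∫ t in Set.Ioo (0:ℝ) r, B t) ^ (1 / q) *
            (∫ t in {t : ℝ | r < t ∧ ENNReal.ofReal t < s}, (A t)⁻¹) ^ ((1:ℝ) / 2)} ≤ C := by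
  set S : Set ℝ := {t : ℝ | 0 < t ∧ ENNReal.ofReal t < s} with hSdef
  have hSm : MeasurableSet S :=
    measurableSet_Ioi.inter (measurableSet_lt ENNReal.measurable_ofReal measurable_const)
  have hq0 : 0 < q := by linarith
  refine Real.sSup_le ?_ hC.le
  rintro k ⟨r, hr, rfl⟩
  have hrS : Set.Ioo 0 r ⊆ S := fun t ht =>
    ⟨ht.1, (ENNReal.ofReal_le_ofReal ht.2.le).trans_lt hr.2⟩
  have hβ0 : 0 ≤ ∫ t in Set.Ioo 0 r, B t :=
    setIntegral_nonneg measurableSet_Ioo fun t ht => hBnn t (hrS ht)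
  rcases hβ0.eq_or_lt with hβ | hβ
  · rw [← hβ, Real.zero_rpow (by positivity), zero_mul]
    exact hC.le
  set β := (∫ t in Set.Ioo 0 r, B t) ^ (1 / q) with hβdef
  have hβpos : 0 < β := Real.rpow_pos_of_pos hβ _
  have main : ∀ c, r < c → ENNReal.ofReal c < s →
      β / C * (∫ t in Set.Ioo r c, (A t)⁻¹) ^ ((1 : ℝ) / 2) ≤ 1 := by
    intro c hrc hcs
    have hcS : Set.Ioo 0 c ⊆ S := fun t ht =>
      ⟨ht.1, (ENNReal.ofReal_le_ofReal ht.2.le).trans_lt hcs⟩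
    have hrcS : Set.Ioo r c ⊆ S := (Set.Ioo_subset_Ioo_left hr.1.le).trans hcS
    refine mul_integral_inv_rpow_le_one hrc (div_pos hβpos hC) hAm
      (fun t ht => hAnn t (hrcS ht))
      ((hAint r hr).mono_set fun t ht => ⟨ht.1, (hrcS ht).2⟩) ?_
    intro φ hφ hφ0 hφz
    have hder : ∀ t, HasDerivAt (fun t => ∫ x in t..c, φ x) (-φ t) t := fun t =>
      intervalIntegral.integral_hasDerivAt_left (hφ.intervalIntegrable _ _)
        hφ.stronglyMeasurable.stronglyMeasurableAtFilter hφ.continuousAt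
    have hderiv : deriv (fun t => ∫ x in t..c, φ x) = fun t => -φ t :=
      funext fun t => (hder t).deriv
    have huz : ∀ t, c ≤ t → ∫ x in t..c, φ x = 0 := by
      intro t ht
      refine (intervalIntegral.integral_congr (g := fun _ => 0) fun x hx => ?_).trans (by simp)
      rw [Set.uIcc_of_ge ht] at hx
      exact hφz x fun h => absurd h.2 (not_lt.2 hx.1)
    have hu := hineq (fun t => ∫ x in t..c, φ x)
      (contDiff_one_iff_deriv.2 ⟨fun t => (hder t).differentiableAt, by
        rw [hderiv]; exact hφ.neg⟩).contDiffOn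
      (fun hst => huz _ ((ENNReal.ofReal_le_iff_le_toReal hst).1 hcs.le))
      (fun _ => ⟨c, huz⟩)
    have hlow := rpow_mul_integral_le_of_primitive hrc hq0 hSm hcS (fun t ht => ht.1)
      hBnn (hBint c ⟨hr.1.trans hrc, hcs⟩) hφ hφ0 hφz
    have hright : ∫ t in S, A t * (deriv (fun t => ∫ x in t..c, φ x) t) ^ 2 =
        ∫ t in Set.Ioo r c, A t * φ t ^ 2 := by
      simp only [hderiv, neg_sq]
      refine setIntegral_eq_of_subset_of_forall_sdiff_eq_zero hSm hrcS fun t ht => ?_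
      simp [hφz t ht.2]
    rw [hright] at hu
    rw [div_mul_eq_mul_div, div_le_iff₀ hC, mul_comm _ C]
    exact hlow.trans hu
  obtain ⟨e, hemono, heS, helim⟩ := exists_seq_strictMono_tendsto' hr.2
  have hetop : ∀ n, e n ≠ ⊤ := fun n => (heS n).2.ne_top
  have hofReal : ∀ n, ENNReal.ofReal (e n).toReal = e n := fun n => ENNReal.ofReal_toReal (hetop n)
  have hre : ∀ n, r < (e n).toReal := fun n =>
    (ENNReal.ofReal_lt_iff_lt_toReal hr.1.le (hetop n)).1 (heS n).1
  have hunion : ⋃ n, Set.Ioo r (e n).toReal = {t : ℝ | r < t ∧ ENNReal.ofReal t < s} := by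
    ext t
    simp only [Set.mem_iUnion, Set.mem_Ioo, Set.mem_ofPred_eq]
    constructor
    · rintro ⟨n, h1, h2⟩
      refine ⟨h1, (ENNReal.ofReal_le_ofReal h2.le).trans_lt ?_⟩
      rw [hofReal]
      exact (heS n).2
    · rintro ⟨h1, h2⟩
      obtain ⟨n, hn⟩ := (helim.eventually (lt_mem_nhds h2)).exists
      exact ⟨n, h1, (ENNReal.ofReal_lt_iff_lt_toReal (hr.1.trans h1).le (hetop n)).1 hn⟩
  have hlim := tendsto_setIntegral_of_monotone (μ := volume) (f := fun t => (A t)⁻¹)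
    (s := fun n => Set.Ioo r (e n).toReal) (fun n => measurableSet_Ioo)
    (fun m n hmn => Set.Ioo_subset_Ioo_right
      (ENNReal.toReal_mono (hetop n) (hemono.monotone hmn)))
    (by rw [hunion]; exact hAint r hr)
  rw [hunion] at hlim
  have hfin : β / C * (∫ t in {t : ℝ | r < t ∧ ENNReal.ofReal t < s}, (A t)⁻¹) ^ ((1 : ℝ) / 2)
      ≤ 1 :=
    le_of_tendsto' ((hlim.rpow_const (Or.inr (by norm_num))).const_mul (β / C)) fun n =>
      main _ (hre n) (by rw [hofReal]; exact (heS n).2)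
  rwa [div_mul_eq_mul_div, div_le_one hC] at hfin
end

section
/- Let A, ε, μ > 0 and p > 1 be constants, and set a_∞ = (ε/μ)^{1/(p−1)}. Then there exists a function a ∈ C²(ℝ) with a(t) > 0 for all t ∈ ℝ, solving a″(t) + A a′(t) − ε a(t) + μ a(t)^p = 0 on ℝ, satisfying lim_{t→−∞} a(t) = 0, lim_{t→+∞} a(t) = a_∞, and normalized so that a(0) = a_∞/2. -/
open Real Filter

open Set Topology MeasureTheory

lemma exists_primitive_of_abs_le_exp {g : ℝ → ℝ} (hg : Continuous g) {B k : ℝ} (hk : 0 < k)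
    (hB : ∀ t, |g t| ≤ B * exp (k * t)) :
    ∃ P : ℝ → ℝ, (∀ t, HasDerivAt P (g t) t) ∧ ∀ t, |P t| ≤ B / k * exp (k * t) := by
  have hexp (t : ℝ) : IntegrableOn (fun s => B * exp (k * s)) (Iic t) :=
    (integrableOn_exp_mul_Iic hk t).const_mul B
  have hint (t : ℝ) : IntegrableOn g (Iic t) :=
    (hexp t).mono' hg.aestronglyMeasurable (Eventually.of_forall hB)
  refine ⟨fun t => ∫ s in Iic t, g s, fun t => ?_, fun t => ?_⟩
  · have heq : (fun t => ∫ s in Iic t, g s) = fun t => (∫ s in Iic 0, g s) + ∫ s in 0..t, g s := by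
      funext t
      rw [← intervalIntegral.integral_Iic_sub_Iic (hint 0) (hint t)]
      ring
    rw [heq]
    exact (hg.integral_hasStrictDerivAt 0 t).hasDerivAt.const_add _
  · have h := norm_integral_le_of_norm_le (hexp t) (f := g) (Eventually.of_forall hB)
    rw [integral_const_mul, integral_exp_mul_Iic hk] at h
    rw [div_mul_eq_mul_div, ← mul_div_assoc] at *
    exact h

/-- If `P` vanishes at `-∞` and `|P'| ≤ G'` with `G` nonnegative, then `|P| ≤ G`. -/
lemma abs_le_of_abs_deriv_le {P P' G G' : ℝ → ℝ} (hP : ∀ t, HasDerivAt P (P' t) t)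
    (hG : ∀ t, HasDerivAt G (G' t) t) (hle : ∀ t, |P' t| ≤ G' t) (hG0 : ∀ t, 0 ≤ G t)
    (hlim : Tendsto P atBot (𝓝 0)) (t : ℝ) : |P t| ≤ G t := by
  have key {Q Q' : ℝ → ℝ} (hQ : ∀ t, HasDerivAt Q (Q' t) t) (hQle : ∀ t, Q' t ≤ G' t)
      (hQlim : Tendsto Q atBot (𝓝 0)) : Q t ≤ G t := by
    have hmono : Monotone fun s => G s - Q s :=
      monotone_of_hasDerivAt_nonneg (fun s => (hG s).sub (hQ s)) fun s => sub_nonneg.2 (hQle s)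
    have h0 : -0 ≤ G t - Q t := by
      refine le_of_tendsto hQlim.neg ((eventually_le_atBot t).mono fun s hs => ?_)
      have h1 : G s - Q s ≤ G t - Q t := hmono hs
      linarith [hG0 s]
    linarith
  refine abs_le'.2 ⟨key hP (fun s => (le_abs_self _).trans (hle s)) hlim, ?_⟩
  refine key (Q := fun s => -P s) (fun s => (hP s).neg)
    (fun s => (neg_le_abs _).trans (hle s)) ?_
  simpa using hlim.neg

lemma tendsto_const_mul_exp_atBot (K : ℝ) {k : ℝ} (hk : 0 < k) :
    Tendsto (fun t : ℝ => K * exp (k * t)) atBot (𝓝 0) := by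
  simpa using (tendsto_exp_atBot.comp (tendsto_id.const_mul_atBot hk)).const_mul K

lemma tendsto_zero_of_abs_le_exp {f : ℝ → ℝ} {K k : ℝ} (hk : 0 < k)
    (hf : ∀ t, |f t| ≤ K * exp (k * t)) : Tendsto f atBot (𝓝 0) :=
  squeeze_zero_norm hf (tendsto_const_mul_exp_atBot K hk)

lemma hasDerivAt_exp_const_mul (k t : ℝ) :
    HasDerivAt (fun s => exp (k * s)) (k * exp (k * t)) t := by
  simpa [mul_comm] using ((hasDerivAt_id t).const_mul k).exp

/-- `w` and its derivative `z` solve `w'' + σ w' + μ e^{βt} v = 0` with `w → 1` at `-∞`, both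
with exponential rate `β`. -/
structure IsResponse (μ σ β : ℝ) (v w z : ℝ → ℝ) : Prop where
  deriv_fst : ∀ t, HasDerivAt w (z t) t
  deriv_snd : ∀ t, HasDerivAt z (-σ * z t - μ * exp (β * t) * v t) t
  bound_fst : ∃ K, ∀ t, |w t - 1| ≤ K * exp (β * t)
  bound_snd : ∃ K, ∀ t, |z t| ≤ K * exp (β * t)

lemma exists_isResponse {μ σ β : ℝ} (hμ : 0 < μ) (hσ : 0 < σ) (hβ : 0 < β) {v : ℝ → ℝ}
    (hv : Continuous v) (hv1 : ∀ t, |v t| ≤ 1) : ∃ w z, IsResponse μ σ β v w z := by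
  obtain ⟨J, hJ, hJb⟩ := exists_primitive_of_abs_le_exp (k := σ + β) (B := μ)
    (g := fun t => μ * exp ((σ + β) * t) * v t) (by fun_prop) (by positivity) (fun t => by
      rw [abs_mul, abs_of_pos (by positivity)]
      exact mul_le_of_le_one_right (by positivity) (hv1 t))
  have hz (t : ℝ) : HasDerivAt (fun t => -(exp (-σ * t) * J t))
      (-σ * -(exp (-σ * t) * J t) - μ * exp (β * t) * v t) t := by
    convert! ((hasDerivAt_exp_const_mul (-σ) t).mul (hJ t)).neg using 1
    rw [show β * t = -σ * t + (σ + β) * t by ring, exp_add]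
    ring
  have hzb (t : ℝ) : |-(exp (-σ * t) * J t)| ≤ μ / (σ + β) * exp (β * t) := by
    rw [abs_neg, abs_mul, abs_of_pos (exp_pos _),
      show β * t = -σ * t + (σ + β) * t by ring, exp_add]
    calc _ ≤ exp (-σ * t) * (μ / (σ + β) * exp ((σ + β) * t)) := by gcongr; exact hJb t
      _ = _ := by ring
  obtain ⟨P, hP, hPb⟩ := exists_primitive_of_abs_le_exp
    (continuous_iff_continuousAt.2 fun t => (hz t).continuousAt) hβ hzb
  exact ⟨fun t => 1 + P t, _, fun t => (hP t).const_add 1, hz, ⟨_, fun t => by simpa using hPb t⟩,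
    ⟨_, hzb⟩⟩

/-- Weighted Lipschitz dependence of the response on the forcing. -/
lemma IsResponse.abs_sub_le {μ σ β C D : ℝ} (hμ : 0 < μ) (hσ : 0 < σ) (hβ : 0 < β) (hC : 0 < C)
    (hD : 0 ≤ D) {v₁ w₁ z₁ v₂ w₂ z₂ : ℝ → ℝ} (h₁ : IsResponse μ σ β v₁ w₁ z₁)
    (h₂ : IsResponse μ σ β v₂ w₂ z₂)
    (hv : ∀ t, |v₁ t - v₂ t| ≤ D * exp (C * exp (β * t))) (t : ℝ) :
    |w₁ t - w₂ t| ≤ μ / (σ * (β * C)) * D * exp (C * exp (β * t)) := by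
  have hΦ (t : ℝ) : HasDerivAt (fun t => exp (C * exp (β * t)))
      (exp (C * exp (β * t)) * (C * (β * exp (β * t)))) t :=
    ((hasDerivAt_exp_const_mul β t).const_mul C).exp
  obtain ⟨K₁, hK₁⟩ := h₁.bound_fst
  obtain ⟨K₂, hK₂⟩ := h₂.bound_fst
  obtain ⟨M₁, hM₁⟩ := h₁.bound_snd
  obtain ⟨M₂, hM₂⟩ := h₂.bound_snd
  have hy (t : ℝ) : HasDerivAt (fun t => exp (σ * t) * (z₁ t - z₂ t))
      (-(μ * (exp (σ * t) * exp (β * t)) * (v₁ t - v₂ t))) t := by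
    convert! (hasDerivAt_exp_const_mul σ t).mul ((h₁.deriv_snd t).sub (h₂.deriv_snd t)) using 1
    simp only [Pi.sub_apply]
    ring
  have hylim : Tendsto (fun t => exp (σ * t) * (z₁ t - z₂ t)) atBot (𝓝 0) := by
    have := (tendsto_const_mul_exp_atBot 1 hσ).mul
      ((tendsto_zero_of_abs_le_exp hβ hM₁).sub (tendsto_zero_of_abs_le_exp hβ hM₂))
    simpa using this
  have hz (t : ℝ) : |z₁ t - z₂ t| ≤ μ / σ * D * (exp (β * t) * exp (C * exp (β * t))) := by
    have hb := abs_le_of_abs_deriv_le hy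
      (G := fun t => μ / σ * D * (exp (σ * t) * (exp (β * t) * exp (C * exp (β * t)))))
      (fun t => (((hasDerivAt_exp_const_mul σ t).mul
        ((hasDerivAt_exp_const_mul β t).mul (hΦ t))).const_mul (μ / σ * D)))
      (fun t => by
        rw [abs_neg, abs_mul, abs_of_pos (by positivity)]
        calc _ ≤ μ * (exp (σ * t) * exp (β * t)) * (D * exp (C * exp (β * t))) := by
              gcongr; exact hv t
          _ = μ / σ * D * (σ * exp (σ * t) * (exp (β * t) * exp (C * exp (β * t)))) := by
              field_simp
          _ ≤ _ := by
              gcongr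
              simp only [Pi.mul_apply]
              exact le_add_of_nonneg_right (by positivity))
      (fun t => by positivity) hylim t
    rw [abs_mul, abs_of_pos (exp_pos _)] at hb
    refine le_of_mul_le_mul_left (hb.trans_eq ?_) (exp_pos (σ * t))
    ring
  refine abs_le_of_abs_deriv_le (fun t => (h₁.deriv_fst t).sub (h₂.deriv_fst t))
    (fun t => (hΦ t).const_mul _) (fun t => (hz t).trans_eq ?_) (fun t => by positivity) ?_ t
  · field_simp
  · have := (tendsto_zero_of_abs_le_exp hβ hK₁).sub (tendsto_zero_of_abs_le_exp hβ hK₂)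
    convert! this using 1
    · funext t; simp
    · simp

noncomputable def clampedPow (p x : ℝ) : ℝ := max 0 (min x 1) ^ p

lemma clampedPow_nonneg (p x : ℝ) : 0 ≤ clampedPow p x := rpow_nonneg (le_max_left _ _) p

lemma clampedPow_le_one {p : ℝ} (hp : 0 ≤ p) (x : ℝ) : clampedPow p x ≤ 1 :=
  rpow_le_one (le_max_left _ _) (max_le zero_le_one (min_le_right _ _)) hp

lemma clampedPow_of_le_one (p : ℝ) {x : ℝ} (hx : x ≤ 1) : clampedPow p x = max 0 x ^ p := by
  rw [clampedPow, min_eq_left hx]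

lemma abs_clampedPow_sub_le {p : ℝ} (hp : 1 ≤ p) (x y : ℝ) :
    |clampedPow p x - clampedPow p y| ≤ p * |x - y| := by
  have hmem (x : ℝ) : max 0 (min x 1) ∈ Icc (0 : ℝ) 1 :=
    ⟨le_max_left _ _, max_le zero_le_one (min_le_right _ _)⟩
  have h := (convex_Icc (0 : ℝ) 1).norm_image_sub_le_of_norm_hasDerivWithin_le (C := p)
    (f := fun x => x ^ p) (fun x _ => (hasDerivAt_rpow_const (Or.inr hp)).hasDerivWithinAt)
    (fun x hx => by
      rw [norm_of_nonneg (mul_nonneg (by linarith) (rpow_nonneg hx.1 _))]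
      exact mul_le_of_le_one_right (by linarith) (rpow_le_one hx.1 hx.2 (by linarith)))
    (hmem y) (hmem x)
  refine h.trans (mul_le_mul_of_nonneg_left ?_ (by linarith))
  rw [Real.norm_eq_abs, max_comm 0, max_comm 0]
  refine (abs_max_sub_max_le_abs _ _ _).trans ((abs_min_sub_min_le_max _ _ _ _).trans ?_)
  simp

lemma continuous_clampedPow {p : ℝ} (hp : 0 ≤ p) : Continuous (clampedPow p) :=
  (continuous_const.max (continuous_id.min continuous_const)).rpow_const fun _ => Or.inr hp

open BoundedContinuousFunction in
/-- Contraction for the Bielecki norm `sup |w| exp (-C e^{βt})`. -/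
lemma exists_isResponse_clampedPow {μ σ β p : ℝ} (hμ : 0 < μ) (hσ : 0 < σ) (hβ : 0 < β)
    (hp : 1 ≤ p) : ∃ w z, IsResponse μ σ β (fun t => clampedPow p (w t)) w z := by
  have hp0 : 0 < p := by linarith
  set C := 2 * (μ * p) / (σ * β) with hCdef
  have hC : 0 < C := by positivity
  have hres (u : ℝ →ᵇ ℝ) := exists_isResponse hμ hσ hβ
    (v := fun t => clampedPow p (exp (C * exp (β * t)) * u t))
    ((continuous_clampedPow hp0.le).comp (by fun_prop)) fun t => by
      rw [abs_of_nonneg (clampedPow_nonneg _ _)]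
      exact clampedPow_le_one hp0.le _
  choose W Z hWZ using hres
  have hbdd (u : ℝ →ᵇ ℝ) : ∃ K, ∀ t, ‖exp (-(C * exp (β * t))) * W u t‖ ≤ K := by
    obtain ⟨K, hK⟩ := (hWZ u).bound_fst
    have hK0 : 0 ≤ K := by simpa using (abs_nonneg _).trans (hK 0)
    refine ⟨1 + K / C, fun t => ?_⟩
    have h1 : |W u t| ≤ 1 + K * exp (β * t) := by
      have := abs_add_le (W u t - 1) 1
      simp only [sub_add_cancel, abs_one] at this
      linarith [hK t]
    have h2 : C * exp (β * t) ≤ exp (C * exp (β * t)) := by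
      linarith [add_one_le_exp (C * exp (β * t))]
    have h3 : 1 ≤ exp (C * exp (β * t)) := one_le_exp (by positivity)
    rw [norm_mul, Real.norm_eq_abs, Real.norm_eq_abs, abs_of_pos (exp_pos _), exp_neg,
      inv_mul_le_iff₀ (exp_pos _)]
    refine h1.trans ?_
    have h4 : K * exp (β * t) = K / C * (C * exp (β * t)) := by field_simp
    rw [h4, mul_add, mul_one, mul_comm _ (K / C)]
    gcongr
  choose K hK using hbdd
  have hcont (u : ℝ →ᵇ ℝ) : Continuous fun t => exp (-(C * exp (β * t))) * W u t := by
    have : Continuous (W u) :=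
      continuous_iff_continuousAt.2 fun t => ((hWZ u).deriv_fst t).continuousAt
    fun_prop
  let T (u : ℝ →ᵇ ℝ) : ℝ →ᵇ ℝ := BoundedContinuousFunction.ofNormedAddCommGroup _ (hcont u) _ (hK u)
  have hT : ContractingWith (1 / 2) T := by
    refine ⟨by rw [← NNReal.coe_lt_coe]; norm_num, LipschitzWith.of_dist_le_mul fun u₁ u₂ => ?_⟩
    refine (BoundedContinuousFunction.dist_le (mul_nonneg (1 / 2 : NNReal).2 dist_nonneg)).2
      fun t => ?_
    have h := (hWZ u₁).abs_sub_le hμ hσ hβ hC (D := p * dist u₁ u₂) (by positivity) (hWZ u₂)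
      (fun t => by
        refine (abs_clampedPow_sub_le hp _ _).trans ?_
        rw [← mul_sub, abs_mul, abs_of_pos (exp_pos _), mul_assoc, mul_comm (dist u₁ u₂)]
        gcongr
        exact BoundedContinuousFunction.dist_coe_le_dist (f := u₁) (g := u₂) t) t
    change dist (exp (-(C * exp (β * t))) * W u₁ t) (exp (-(C * exp (β * t))) * W u₂ t) ≤ _
    rw [Real.dist_eq, ← mul_sub, abs_mul, abs_of_pos (exp_pos _), exp_neg,
      inv_mul_le_iff₀ (exp_pos _)]
    refine h.trans_eq ?_
    have hhalf : ((1 / 2 : NNReal) : ℝ) = 1 / 2 := by norm_num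
    change _ = exp (C * exp (β * t)) * (((1 / 2 : NNReal) : ℝ) * dist u₁ u₂)
    rw [hhalf, hCdef]
    field_simp
  obtain ⟨u, hu⟩ : ∃ u, T u = u := ⟨hT.fixedPoint T, hT.fixedPoint_isFixedPt⟩
  refine ⟨W u, Z u, ?_⟩
  convert! hWZ u using 3 with t
  have hut : u t = exp (-(C * exp (β * t))) * W u t := (DFunLike.congr_fun hu t).symm
  rw [hut, ← mul_assoc, ← exp_add, add_neg_cancel, exp_zero, one_mul]

/-- A trajectory on the unstable manifold of the origin, with the nonlinearity extended by zero to
negative values. -/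
lemma exists_unstable_trajectory {A ε μ p : ℝ} (hA : 0 < A) (hε : 0 < ε) (hμ : 0 < μ)
    (hp : 1 < p) : ∃ a b : ℝ → ℝ, (∀ t, HasDerivAt a (b t) t) ∧
      (∀ t, HasDerivAt b (-A * b t + ε * a t - μ * max 0 (a t) ^ p) t) ∧
      Tendsto a atBot (𝓝 0) ∧ Tendsto b atBot (𝓝 0) ∧ ∀ᶠ t in atBot, 0 < a t ∧ 0 < b t := by
  obtain ⟨l, hl, hroot⟩ : ∃ l, 0 < l ∧ l ^ 2 + A * l = ε := by
    have hsq : √(A ^ 2 + 4 * ε) ^ 2 = A ^ 2 + 4 * ε := sq_sqrt (by positivity)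
    refine ⟨(√(A ^ 2 + 4 * ε) - A) / 2, ?_, by linarith⟩
    have : A < √(A ^ 2 + 4 * ε) := lt_sqrt_of_sq_lt (by linarith)
    linarith
  have hσ : 0 < 2 * l + A := by positivity
  have hβ : 0 < (p - 1) * l := mul_pos (by linarith) hl
  obtain ⟨w, z, h⟩ := exists_isResponse_clampedPow hμ hσ hβ hp.le
  obtain ⟨K, hK⟩ := h.bound_fst
  obtain ⟨M, hM⟩ := h.bound_snd
  have hw1 : Tendsto w atBot (𝓝 1) := by
    simpa using (tendsto_zero_of_abs_le_exp hβ hK).add_const 1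
  have hz0 : Tendsto z atBot (𝓝 0) := tendsto_zero_of_abs_le_exp hβ hM
  have hexp0 : Tendsto (fun t => exp (l * t)) atBot (𝓝 0) := by
    simpa using tendsto_const_mul_exp_atBot 1 hl
  have hz (t : ℝ) : z t ≤ 0 := by
    have hanti : Antitone fun t => exp ((2 * l + A) * t) * z t := by
      refine antitone_of_hasDerivAt_nonpos
        (fun t => (hasDerivAt_exp_const_mul _ t).mul (h.deriv_snd t)) fun t => ?_
      have := mul_nonneg (by positivity : 0 ≤ exp ((2 * l + A) * t) *
        (μ * exp ((p - 1) * l * t))) (clampedPow_nonneg p (w t))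
      simp only [Pi.zero_apply]
      linarith
    have hlim : Tendsto (fun t => exp ((2 * l + A) * t) * z t) atBot (𝓝 0) := by
      simpa using (tendsto_const_mul_exp_atBot 1 hσ).mul hz0
    have := hanti.ge_of_tendsto hlim t
    exact nonpos_of_mul_nonpos_right this (exp_pos _)
  have hw (t : ℝ) : w t ≤ 1 :=
    (antitone_of_hasDerivAt_nonpos h.deriv_fst hz).ge_of_tendsto hw1 t
  have ha (t : ℝ) : HasDerivAt (fun t => exp (l * t) * w t) (exp (l * t) * (l * w t + z t)) t := by
    convert! (hasDerivAt_exp_const_mul l t).mul (h.deriv_fst t) using 1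
    ring
  refine ⟨fun t => exp (l * t) * w t, fun t => exp (l * t) * (l * w t + z t), ha, fun t => ?_,
    by simpa using hexp0.mul hw1, by simpa using hexp0.mul ((hw1.const_mul l).add hz0), ?_⟩
  · convert! (hasDerivAt_exp_const_mul l t).mul
      (((h.deriv_fst t).const_mul l).add (h.deriv_snd t)) using 1
    have hpow : max 0 (exp (l * t) * w t) ^ p
        = exp (l * t) * (exp ((p - 1) * l * t) * clampedPow p (w t)) := by
      rw [clampedPow_of_le_one p (hw t), ← mul_assoc, ← exp_add,
        show l * t + (p - 1) * l * t = l * t * p by ring, exp_mul (l * t),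
        ← mul_rpow (exp_pos _).le (le_max_left _ _), mul_max_of_nonneg _ _ (exp_pos _).le, mul_zero]
    rw [hpow, ← hroot]
    simp only [Pi.add_apply]
    ring
  · have hpos : Tendsto (fun t => l * w t + z t) atBot (𝓝 l) := by
      simpa using (hw1.const_mul l).add hz0
    filter_upwards [hw1.eventually_const_lt one_pos, hpos.eventually_const_lt hl] with t h1 h2
    exact ⟨mul_pos (exp_pos _) h1, mul_pos (exp_pos _) h2⟩

lemma integral_zero_max_rpow (μ : ℝ) {p x : ℝ} (hp : 0 < p) (hx : 0 ≤ x) :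
    ∫ y in 0..x, μ * max 0 y ^ p = μ * x ^ (p + 1) / (p + 1) := by
  have : ∫ y in 0..x, μ * max 0 y ^ p = ∫ y in 0..x, μ * y ^ p := by
    refine intervalIntegral.integral_congr fun y hy => ?_
    rw [uIcc_of_le hx] at hy
    simp only [max_eq_right hy.1]
  rw [this, intervalIntegral.integral_const_mul, integral_rpow (Or.inl (by linarith)),
    zero_rpow (by linarith)]
  ring

/-- The energy is nonincreasing along the unstable trajectory and tends to `0` at `-∞`, so it is
negative throughout and the trajectory never returns to `a = 0`. -/
lemma exists_pos_trajectory {A ε μ p : ℝ} (hA : 0 < A) (hε : 0 < ε) (hμ : 0 < μ)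
    (hp : 1 < p) : ∃ a b E : ℝ → ℝ, (∀ t, HasDerivAt a (b t) t) ∧
      (∀ t, HasDerivAt b (-A * b t + ε * a t - μ * a t ^ p) t) ∧
      Tendsto a atBot (𝓝 0) ∧ (∀ t, 0 < a t) ∧
      (∀ t, HasDerivAt E (-A * b t ^ 2) t) ∧ (∀ t, E t < 0) ∧
      ∀ t, E t = b t ^ 2 / 2 - ε * a t ^ 2 / 2 + μ * a t ^ (p + 1) / (p + 1) := by
  obtain ⟨a, b, ha, hb, ha0, hb0, hev⟩ := exists_unstable_trajectory hA hε hμ hp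
  have hcont : Continuous fun y : ℝ => μ * max 0 y ^ p :=
    ((continuous_const.max continuous_id).rpow_const fun _ => Or.inr (by linarith)).const_mul μ
  set F : ℝ → ℝ := fun x => ∫ y in 0..x, μ * max 0 y ^ p with hFdef
  have hF (x : ℝ) : HasDerivAt F (μ * max 0 x ^ p) x :=
    (hcont.integral_hasStrictDerivAt 0 x).hasDerivAt
  have hF0 : F 0 = 0 := intervalIntegral.integral_same
  set E : ℝ → ℝ := fun t => b t ^ 2 / 2 - ε * a t ^ 2 / 2 + F (a t) with hEdef
  have hE (t : ℝ) : HasDerivAt E (-A * b t ^ 2) t := by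
    convert! ((((hb t).pow 2).div_const 2).sub ((((ha t).pow 2).const_mul ε).div_const 2)).add
      ((hF (a t)).comp t (ha t)) using 1
    push_cast
    ring
  have hanti : Antitone E := antitone_of_hasDerivAt_nonpos hE fun t => by
    have := mul_nonneg hA.le (sq_nonneg (b t))
    simp only [Pi.zero_apply]
    linarith
  have hE0 : Tendsto E atBot (𝓝 0) := by
    have h1 : Tendsto (fun t => F (a t)) atBot (𝓝 0) := by
      have := (hF 0).continuousAt.tendsto.comp ha0
      rwa [hF0] at this
    simpa using (((hb0.pow 2).div_const 2).sub (((ha0.pow 2).const_mul ε).div_const 2)).add h1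
  have hneg (t : ℝ) : E t < 0 := by
    refine (hanti.ge_of_tendsto hE0 t).lt_of_ne fun ht => ?_
    obtain ⟨s, hs, -, hbs⟩ := ((eventually_lt_atBot t).and hev).exists
    have hloc : E =ᶠ[𝓝 s] fun _ => 0 := (eventually_lt_nhds hs).mono fun r hr =>
      le_antisymm (hanti.ge_of_tendsto hE0 r) (ht ▸ hanti hr.le)
    have h0 := (hE s).unique ((hasDerivAt_const s (0 : ℝ)).congr_of_eventuallyEq hloc)
    have : 0 < A * b s ^ 2 := by positivity
    linarith
  have hne (t : ℝ) : a t ≠ 0 := fun h => by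
    have := hneg t
    simp only [hEdef, h, hF0] at this
    nlinarith [sq_nonneg (b t)]
  have hacont : Continuous a := continuous_iff_continuousAt.2 fun t => (ha t).continuousAt
  have hpos (t : ℝ) : 0 < a t := by
    by_contra! ht
    obtain ⟨s, hs, -⟩ := hev.exists
    obtain ⟨r, hr⟩ := mem_range_of_exists_le_of_exists_ge hacont ⟨t, ht⟩ ⟨s, hs.le⟩
    exact hne r hr
  refine ⟨a, b, E, ha, fun t => ?_, ha0, hpos, hE, hneg, fun t => ?_⟩
  · simpa only [max_eq_right (hpos t).le] using hb t
  · simp only [hEdef, hFdef, integral_zero_max_rpow μ (by linarith : 0 < p) (hpos t).le]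

/-- Barbalat: a convergent function with bounded second derivative has vanishing derivative. -/
lemma tendsto_deriv_zero_of_tendsto {f g h : ℝ → ℝ} {l K : ℝ} (hf : ∀ t, HasDerivAt f (g t) t)
    (hg : ∀ t, HasDerivAt g (h t) t) (hK : ∀ t, |h t| ≤ K) (hl : Tendsto f atTop (𝓝 l)) :
    Tendsto g atTop (𝓝 0) := by
  have hK0 : 0 ≤ K := (abs_nonneg _).trans (hK 0)
  have hbound (t : ℝ) {δ : ℝ} (hδ : 0 < δ) : |g t| ≤ K * δ + |f (t + δ) - f t| / δ := by
    obtain ⟨c, hc, hgc⟩ := exists_hasDerivAt_eq_slope f g (lt_add_of_pos_right t hδ)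
      (fun s _ => (hf s).continuousAt.continuousWithinAt) fun s _ => hf s
    have h1 : |g t - g c| ≤ K * |t - c| :=
      convex_univ.norm_image_sub_le_of_norm_hasDerivWithin_le
        (fun s _ => (hg s).hasDerivWithinAt) (fun s _ => hK s) (mem_univ _) (mem_univ _)
    have h2 : |t - c| ≤ δ := by rw [abs_le]; constructor <;> linarith [hc.1, hc.2]
    have h3 : |g c| = |f (t + δ) - f t| / δ := by
      rw [hgc, abs_div, add_sub_cancel_left, abs_of_pos hδ]
    have h4 := abs_add_le (g t - g c) (g c)
    rw [sub_add_cancel, h3] at h4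
    linarith [mul_le_mul_of_nonneg_left h2 hK0]
  rw [Metric.tendsto_nhds]
  intro e he
  set δ := e / (2 * (K + 1)) with hδdef
  have hδ : 0 < δ := by positivity
  have hdiff : Tendsto (fun t => |f (t + δ) - f t| / δ) atTop (𝓝 0) := by
    simpa using (((hl.comp (tendsto_atTop_add_const_right _ δ tendsto_id)).sub hl).abs.div_const δ)
  filter_upwards [hdiff.eventually_lt_const (half_pos he)] with t ht
  have : K * δ ≤ e / 2 := by
    rw [hδdef, mul_div_assoc', div_le_div_iff₀ (by positivity) two_pos]
    nlinarith
  rw [Real.dist_eq, sub_zero]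
  linarith [hbound t hδ]

/-- A positive trajectory of negative energy converges to the positive equilibrium. -/
lemma tendsto_equilibrium_of_energy_neg {A ε μ p : ℝ} (hA : 0 < A) (hε : 0 < ε) (hμ : 0 < μ)
    (hp : 1 < p) {a b E : ℝ → ℝ} (ha : ∀ t, HasDerivAt a (b t) t)
    (hb : ∀ t, HasDerivAt b (-A * b t + ε * a t - μ * a t ^ p) t) (hpos : ∀ t, 0 < a t)
    (hE : ∀ t, HasDerivAt E (-A * b t ^ 2) t) (hneg : ∀ t, E t < 0)
    (hEeq : ∀ t, E t = b t ^ 2 / 2 - ε * a t ^ 2 / 2 + μ * a t ^ (p + 1) / (p + 1)) :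
    Tendsto a atTop (𝓝 ((ε / μ) ^ (1 / (p - 1)))) := by
  have hp1 : 0 < p - 1 := by linarith
  set Q := ε * (p + 1) / (2 * μ) with hQ
  have hq (t : ℝ) : a t ^ (p - 1) ≤ Q := by
    have hsplit : a t ^ (p + 1) = a t ^ 2 * a t ^ (p - 1) := by
      rw [← rpow_natCast, ← rpow_add (hpos t)]
      congr 1
      push_cast
      ring
    have h1 : μ * a t ^ (p + 1) / (p + 1) ≤ ε * a t ^ 2 / 2 := by
      linarith [hneg t, hEeq t, sq_nonneg (b t)]
    rw [hsplit, div_le_div_iff₀ (by linarith) two_pos] at h1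
    rw [hQ, le_div_iff₀ (by positivity)]
    refine le_of_mul_le_mul_left ?_ (pow_pos (hpos t) 2)
    linarith
  set M := Q ^ (1 / (p - 1)) with hM
  have haM (t : ℝ) : a t ≤ M := by
    have := rpow_le_rpow (rpow_nonneg (hpos t).le _) (hq t) (one_div_pos.2 hp1).le
    rwa [← rpow_mul (hpos t).le, mul_one_div_cancel hp1.ne', rpow_one] at this
  have hM0 : 0 < M := (hpos 0).trans_le (haM 0)
  have hpow (t : ℝ) : a t ^ p = a t * a t ^ (p - 1) := by
    conv_rhs => rw [mul_comm, ← rpow_add_one (hpos t).ne', sub_add_cancel]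
  have hQ0 : 0 < Q := by positivity
  obtain ⟨B, hB⟩ : ∃ B, ∀ t, |b t| ≤ B := by
    refine ⟨√(ε * M ^ 2), fun t => abs_le_sqrt ?_⟩
    have h1 : 0 ≤ μ * a t ^ (p + 1) / (p + 1) := by
      have := rpow_nonneg (hpos t).le (p + 1)
      positivity
    have h2 : a t ^ 2 ≤ M ^ 2 := pow_le_pow_left₀ (hpos t).le (haM t) 2
    nlinarith [hneg t, hEeq t]
  have hB0 : 0 ≤ B := (abs_nonneg _).trans (hB 0)
  set c : ℝ → ℝ := fun t => -A * b t + ε * a t - μ * a t ^ p with hc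
  obtain ⟨C, hC⟩ : ∃ C, ∀ t, |c t| ≤ C := by
    refine ⟨A * B + ε * M + μ * (M * Q), fun t => ?_⟩
    have h1 : μ * a t ^ p ≤ μ * (M * Q) := by
      rw [hpow]
      have := rpow_nonneg (hpos t).le (p - 1)
      gcongr
      exacts [haM t, hq t]
    have h2 : 0 ≤ μ * a t ^ p := mul_nonneg hμ.le (rpow_nonneg (hpos t).le _)
    have h3 : ε * a t ≤ ε * M := by gcongr; exact haM t
    have h4 : 0 ≤ ε * a t := mul_nonneg hε.le (hpos t).le
    have h5 := abs_le.1 (hB t)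
    have h6 : A * b t ≤ A * B := by gcongr; exact h5.2
    have h7 : A * -B ≤ A * b t := by gcongr; exact h5.1
    rw [hc, abs_le]
    constructor <;> dsimp only <;> linarith
  have hC0 : 0 ≤ C := (abs_nonneg _).trans (hC 0)
  have hanti : Antitone E := antitone_of_hasDerivAt_nonpos hE fun t => by
    have := mul_nonneg hA.le (sq_nonneg (b t))
    simp only [Pi.zero_apply]
    linarith
  have hElow (t : ℝ) : -(ε * a t ^ 2) / 2 ≤ E t := by
    have h1 : 0 ≤ μ * a t ^ (p + 1) / (p + 1) := by
      have := rpow_nonneg (hpos t).le (p + 1)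
      positivity
    linarith [hEeq t, sq_nonneg (b t)]
  have hElim : Tendsto E atTop (𝓝 (⨅ t, E t)) := by
    refine tendsto_atTop_ciInf hanti ⟨-(ε * M ^ 2) / 2, ?_⟩
    rintro _ ⟨t, rfl⟩
    have h2 : ε * a t ^ 2 ≤ ε * M ^ 2 := by
      gcongr
      exacts [(hpos t).le, haM t]
    linarith [hElow t]
  have hbsq : Tendsto (fun t => -A * b t ^ 2) atTop (𝓝 0) := by
    refine tendsto_deriv_zero_of_tendsto (K := A * (2 * (B * C))) hE
      (fun t => ((hb t).pow 2).const_mul (-A)) (fun t => ?_) hElim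
    have : |b t| * |c t| ≤ B * C := by
      gcongr
      exacts [hB t, hC t]
    rw [abs_mul, abs_neg, abs_of_pos hA]
    gcongr
    simpa [hc, abs_mul, mul_assoc] using this
  have hb0 : Tendsto b atTop (𝓝 0) := by
    have h1 : Tendsto (fun t => √(b t ^ 2)) atTop (𝓝 0) := by
      have := (hbsq.const_mul (-A)⁻¹).sqrt
      simpa [hA.ne'] using this
    simp only [sqrt_sq_eq_abs] at h1
    exact tendsto_zero_iff_abs_tendsto_zero _ |>.2 h1
  have hc0 : Tendsto c atTop (𝓝 0) := by
    refine tendsto_deriv_zero_of_tendsto (K := A * C + ε * B + μ * (B * p * Q)) hb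
      (fun t => (((hb t).const_mul (-A)).add ((ha t).const_mul ε)).sub
        (((ha t).rpow_const (p := p) (Or.inl (hpos t).ne')).const_mul μ)) (fun t => ?_) hb0
    refine (abs_sub _ _).trans (add_le_add ((abs_add_le _ _).trans (add_le_add ?_ ?_)) ?_)
    · rw [abs_mul, abs_neg, abs_of_pos hA]
      gcongr
      exact hC t
    · rw [abs_mul, abs_of_pos hε]
      gcongr
      exact hB t
    · rw [abs_mul, abs_of_pos hμ, abs_mul, abs_mul, abs_of_pos (by linarith : 0 < p),
        abs_of_nonneg (rpow_nonneg (hpos t).le _)]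
      have := rpow_nonneg (hpos t).le (p - 1)
      gcongr
      exacts [hB t, hq t]
  obtain ⟨d, hd0, hd⟩ : ∃ d, 0 < d ∧ ∀ t, 0 ≤ t → d ≤ a t := by
    refine ⟨√(2 * -E 0 / ε), sqrt_pos.2 (div_pos (by linarith [hneg 0]) hε), fun t ht => ?_⟩
    refine sqrt_le_iff.2 ⟨(hpos t).le, ?_⟩
    rw [div_le_iff₀ hε]
    linarith [hElow t, hanti ht]
  have hprod : Tendsto (fun t => a t * (ε - μ * a t ^ (p - 1))) atTop (𝓝 0) := by
    have := hc0.add (hb0.const_mul A)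
    simp only [mul_zero, add_zero] at this
    refine this.congr fun t => ?_
    simp only [hc, hpow]
    ring
  have hfac : Tendsto (fun t => ε - μ * a t ^ (p - 1)) atTop (𝓝 0) := by
    have h1 := hprod.abs.div_const d
    simp only [abs_zero, zero_div] at h1
    refine squeeze_zero_norm' ((eventually_ge_atTop 0).mono fun t ht => ?_) h1
    rw [Real.norm_eq_abs, le_div_iff₀ hd0, abs_mul, abs_of_pos (hpos t), mul_comm]
    gcongr
    exact hd t ht
  have hlim : Tendsto (fun t => a t ^ (p - 1)) atTop (𝓝 (ε / μ)) := by
    have h1 := (hfac.const_sub ε).div_const μ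
    rw [sub_zero] at h1
    refine h1.congr fun t => ?_
    field_simp
    ring
  refine (hlim.rpow_const (p := 1 / (p - 1)) (Or.inl (by positivity))).congr fun t => ?_
  rw [← rpow_mul (hpos t).le, mul_one_div_cancel hp1.ne', rpow_one]

/-- Existence of a positive heteroclinic solution of
`a″ + A a′ − ε a + μ a^p = 0` connecting `0` at `−∞` to `a_∞ = (ε/μ)^{1/(p−1)}`
at `+∞`, normalized by `a(0) = a_∞/2`. -/
theorem stmt8 (A ε μ p : ℝ) (hA : 0 < A) (hε : 0 < ε) (hμ : 0 < μ) (hp : 1 < p) :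
    ∃ a : ℝ → ℝ, ContDiff ℝ 2 a ∧ (∀ t : ℝ, 0 < a t) ∧
      (∀ t : ℝ, deriv (deriv a) t + A * deriv a t - ε * a t + μ * a t ^ p = 0) ∧
      Filter.Tendsto a Filter.atBot (nhds 0) ∧
      Filter.Tendsto a Filter.atTop (nhds ((ε / μ) ^ (1 / (p - 1)))) ∧
      a 0 = (ε / μ) ^ (1 / (p - 1)) / 2 := by
  have hL : 0 < (ε / μ) ^ (1 / (p - 1)) := rpow_pos_of_pos (div_pos hε hμ) _
  obtain ⟨a, b, E, ha, hb, ha0, hpos, hE, hneg, hEeq⟩ := exists_pos_trajectory hA hε hμ hp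
  have htop := tendsto_equilibrium_of_energy_neg hA hε hμ hp ha hb hpos hE hneg hEeq
  have hacont : Continuous a := continuous_iff_continuousAt.2 fun t => (ha t).continuousAt
  have hbcont : Continuous b := continuous_iff_continuousAt.2 fun t => (hb t).continuousAt
  have hda : deriv a = b := funext fun t => (ha t).deriv
  have hdb : deriv b = fun t => -A * b t + ε * a t - μ * a t ^ p := funext fun t => (hb t).deriv
  obtain ⟨t₀, ht₀⟩ : (ε / μ) ^ (1 / (p - 1)) / 2 ∈ range a := by
    refine mem_range_of_exists_le_of_exists_ge hacont ?_ ?_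
    · obtain ⟨t, ht⟩ := (ha0.eventually_lt_const (half_pos hL)).exists
      exact ⟨t, ht.le⟩
    · obtain ⟨t, ht⟩ := (htop.eventually_const_lt (half_lt_self hL)).exists
      exact ⟨t, ht.le⟩
  have hC2 : ContDiff ℝ 2 a := by
    have hb1 : ContDiff ℝ 1 b := by
      refine contDiff_one_iff_deriv.2 ⟨fun t => (hb t).differentiableAt, ?_⟩
      rw [hdb]
      have := hacont.rpow_const (p := p) fun t => Or.inl (hpos t).ne'
      fun_prop
    refine (contDiff_succ_iff_deriv (n := 1)).2 ⟨fun t => (ha t).differentiableAt, by simp, ?_⟩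
    rwa [hda]
  have hshift : deriv (fun t => a (t + t₀)) = fun t => b (t + t₀) := by
    funext t
    rw [deriv_comp_add_const, hda]
  refine ⟨fun t => a (t + t₀), hC2.comp (contDiff_id.add contDiff_const), fun t => hpos _,
    fun t => ?_, ha0.comp (tendsto_atBot_add_const_right _ t₀ tendsto_id),
    htop.comp (tendsto_atTop_add_const_right _ t₀ tendsto_id), by simpa using ht₀⟩
  rw [hshift, deriv_comp_add_const, hdb]
  ring
end

section
/- Let A, ε > 0 and p > 1 with A² > 4(p−1)ε, and set δ̃⁺ = (−A + √(A² − 4(p−1)ε))/2. Let w ∈ C²(ℝ) satisfy w″ + A w′ − ε w + ε w^p = 0 on ℝ, 0 < w(t) < 1 for all t, lim_{t→−∞} w(t) = 0 and lim_{t→+∞} w(t) = 1, and suppose there exist t̂ ∈ ℝ and C₁ ≥ 1 such that for all t ≥ t̂: (1/2) e^{δ̃⁺ t} ≤ 1 − w(t) ≤ 2 e^{δ̃⁺ t} and (1/C₁) w(t)(1 − w(t)) ≤ w′(t) ≤ C₁ w(t)(1 − w(t)). Then there exist t_p ≥ t̂ and a constant C ≥ 1 such that (1/C) e^{δ̃⁺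 t} ≤ −w″(t) ≤ C e^{δ̃⁺ t} for all t ≥ t_p. -/
open Real Filter

/-- A function whose derivative is bounded below by a positive constant on a half-line is eventually
nonnegative. -/
theorem exists_forall_nonneg_of_le_hasDerivAt {H H' : ℝ → ℝ} {T c : ℝ} (hc : 0 < c)
    (hH : ∀ t, HasDerivAt H (H' t) t) (hbound : ∀ t ≥ T, c ≤ H' t) :
    ∃ S ≥ T, ∀ t ≥ S, 0 ≤ H t := by
  refine ⟨T + |H T| / c, by simp; positivity, fun t ht => ?_⟩
  have hTt : T ≤ t := le_trans (by simp; positivity) ht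
  have key := (convex_Ici T).mul_sub_le_image_sub_of_le_deriv (f := H) (C := c)
    (fun x _ => (hH x).continuousAt.continuousWithinAt)
    (fun x _ => (hH x).differentiableAt.differentiableWithinAt)
    (fun x hx => by
      rw [(hH x).deriv]
      exact hbound x (interior_subset hx))
    T Set.self_mem_Ici t hTt hTt
  have h1 : |H T| ≤ c * (t - T) := by
    have h2 : |H T| / c ≤ t - T := by linarith
    rwa [div_le_iff₀' hc] at h2
  linarith [neg_abs_le (H T)]

/-- Bernoulli's inequality at `x`, written around the fixed point `1` of `x ↦ x ^ p`. -/
theorem sub_rpow_le_mul_one_sub {p x : ℝ} (hp : 1 < p) (hx : 0 < x) :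
    x - x ^ p ≤ (p - 1) * (1 - x) := by
  have h := one_add_mul_self_le_rpow_one_add (s := x - 1) (by linarith) hp.le
  rw [add_sub_cancel] at h
  linarith

/-- Near `1`, the first order expansion of `x ↦ x - x ^ p` from below. -/
theorem eventually_mul_one_sub_le_sub_rpow {p η : ℝ} (hη : 0 < η) :
    ∀ᶠ x in nhds (1 : ℝ), x < 1 → (p - 1 - η) * (1 - x) ≤ x - x ^ p := by
  have hd : HasDerivAt (fun x : ℝ => x ^ p) p 1 := by
    simpa using Real.hasDerivAt_rpow_const (x := (1 : ℝ)) (p := p) (Or.inl one_ne_zero)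
  filter_upwards [hd.isLittleO.def hη] with x hx hx1
  simp only [Real.one_rpow, smul_eq_mul, Real.norm_eq_abs] at hx
  rw [abs_of_neg (sub_neg.2 hx1)] at hx
  have := (abs_le.1 hx).2
  linarith

/-- Second-derivative asymptotics of the normalized heteroclinic `w` of
`w″ + A w′ − ε w + ε w^p = 0` near the equilibrium `1`. -/
theorem stmt10 (A ε p : ℝ) (hA : 0 < A) (hε : 0 < ε) (hp : 1 < p)
    (hAε : 4 * (p - 1) * ε < A ^ 2)
    (w : ℝ → ℝ) (hw : ContDiff ℝ 2 w)
    (hode : ∀ t : ℝ, deriv (deriv w) t + A * deriv w t - ε * w t + ε * w t ^ p = 0)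
    (hrange : ∀ t : ℝ, w t ∈ Set.Ioo (0:ℝ) 1)
    (hbot : Filter.Tendsto w Filter.atBot (nhds 0))
    (htop : Filter.Tendsto w Filter.atTop (nhds 1))
    (t₀ C₁ : ℝ) (hC₁ : 1 ≤ C₁)
    (hdecay : ∀ t ≥ t₀,
        (1 / 2) * Real.exp ((-A + Real.sqrt (A ^ 2 - 4 * (p - 1) * ε)) / 2 * t) ≤ 1 - w t ∧
        1 - w t ≤ 2 * Real.exp ((-A + Real.sqrt (A ^ 2 - 4 * (p - 1) * ε)) / 2 * t) ∧
        (1 / C₁) * (w t * (1 - w t)) ≤ deriv w t ∧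
        deriv w t ≤ C₁ * (w t * (1 - w t))) :
    ∃ t_p ≥ t₀, ∃ C ≥ (1:ℝ), ∀ t ≥ t_p,
      (1 / C) * Real.exp ((-A + Real.sqrt (A ^ 2 - 4 * (p - 1) * ε)) / 2 * t) ≤
          -(deriv (deriv w) t) ∧
      -(deriv (deriv w) t) ≤
          C * Real.exp ((-A + Real.sqrt (A ^ 2 - 4 * (p - 1) * ε)) / 2 * t) := by
  have hβ : 0 < (p - 1) * ε := mul_pos (by linarith) hε
  set s := Real.sqrt (A ^ 2 - 4 * (p - 1) * ε)
  have hs2 : s ^ 2 = A ^ 2 - 4 * (p - 1) * ε := Real.sq_sqrt (by linarith)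
  have hs0 : 0 < s := Real.sqrt_pos.2 (by linarith)
  have hsA : s < A := by nlinarith
  obtain ⟨m, hm1, hm2⟩ : ∃ m, (p - 1) * ε / A < m ∧ m < (A - s) / 2 := by
    apply exists_between
    rw [div_lt_iff₀ hA]
    nlinarith [sq_pos_of_pos (sub_pos.2 hsA)]
  rw [div_lt_iff₀ hA] at hm1
  obtain ⟨κ, hκ, hκm⟩ : ∃ κ > 0, m * (A - m) + 2 * κ = (p - 1) * ε := by
    refine ⟨((A - s) / 2 - m) * ((A + s) / 2 - m) / 2, ?_, by linarith⟩
    exact half_pos (mul_pos (by linarith) (by linarith))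
  have hw1 : ∀ t, HasDerivAt w (deriv w t) t := fun t =>
    (hw.differentiable (by norm_num) t).hasDerivAt
  have hw2 : ∀ t, HasDerivAt (deriv w) (deriv (deriv w) t) t := fun t =>
    ((hw.deriv' (n := 1)).differentiable (by norm_num) t).hasDerivAt
  obtain ⟨T, hT⟩ := eventually_atTop.1
    (htop.eventually (eventually_mul_one_sub_le_sub_rpow (p := p) (div_pos hκ hε)))
  have hlow : ∀ t ≥ T, ((p - 1) * ε - κ) * (1 - w t) ≤ ε * (w t - w t ^ p) := fun t ht => by
    have h := mul_le_mul_of_nonneg_left (hT t ht (hrange t).2) hε.le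
    have h' : ε * ((p - 1 - κ / ε) * (1 - w t)) = ((p - 1) * ε - κ) * (1 - w t) := by
      field_simp
    linarith
  have hH : ∀ t, HasDerivAt
      (fun t => (deriv w t - m * (1 - w t)) * Real.exp ((A - m) * t))
      ((ε * (w t - w t ^ p) - m * (A - m) * (1 - w t)) * Real.exp ((A - m) * t)) t := fun t => by
    have h := ((hw2 t).sub (((hw1 t).const_sub 1).const_mul m)).mul
      (((hasDerivAt_id t).const_mul (A - m)).exp)
    refine h.congr_deriv ?_
    simp only [id, Pi.sub_apply]
    linear_combination Real.exp ((A - m) * t) * hode t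
  obtain ⟨S, hST, hS⟩ := exists_forall_nonneg_of_le_hasDerivAt (T := max (max t₀ T) 0)
    (half_pos hκ) hH (fun t ht => by
      have ht₀ : t₀ ≤ t := le_trans (le_trans (le_max_left _ _) (le_max_left _ _)) ht
      have htT : T ≤ t := le_trans (le_trans (le_max_right _ _) (le_max_left _ _)) ht
      have ht0 : 0 ≤ t := le_trans (le_max_right _ _) ht
      have hexp : 1 ≤ Real.exp ((-A + s) / 2 * t) * Real.exp ((A - m) * t) := by
        rw [← Real.exp_add, ← add_mul]
        exact Real.one_le_exp (mul_nonneg (by linarith) ht0)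
      have hv : κ * ((1 / 2) * Real.exp ((-A + s) / 2 * t)) ≤
          ε * (w t - w t ^ p) - m * (A - m) * (1 - w t) := by
        have h := mul_le_mul_of_nonneg_left (hdecay t ht₀).1 hκ.le
        have h' := hlow t htT
        rw [← hκm] at h'
        linarith
      have h := mul_le_mul_of_nonneg_right hv (Real.exp_pos ((A - m) * t)).le
      have h' := mul_le_mul_of_nonneg_left hexp (half_pos hκ).le
      linarith)
  set c := (A * m - (p - 1) * ε) / 2 with hc
  have hc0 : 0 < c := by rw [hc]; linarith
  refine ⟨S, le_trans (le_trans (le_max_left _ _) (le_max_left _ _)) hST,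
    max 1 (max (1 / c) (2 * A * C₁)), le_max_left _ _, fun t ht => ?_⟩
  have ht₀ : t₀ ≤ t :=
    le_trans (le_trans (le_trans (le_max_left _ _) (le_max_left _ _)) hST) ht
  obtain ⟨hv1, hv2, -, hu⟩ := hdecay t ht₀
  obtain ⟨hwt0, hwt1⟩ := hrange t
  have hE := Real.exp_pos ((-A + s) / 2 * t)
  constructor
  · have hCc : 1 / max 1 (max (1 / c) (2 * A * C₁)) ≤ c := by
      rw [one_div_le (by positivity) hc0]
      exact le_trans (le_max_left _ _) (le_max_right _ _)
    have hum : m * (1 - w t) ≤ deriv w t := by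
      have := nonneg_of_mul_nonneg_left (hS t ht) (Real.exp_pos _)
      linarith
    have h1 := mul_le_mul_of_nonneg_right hCc hE.le
    have h2 := mul_le_mul_of_nonneg_left hum hA.le
    have h3 := mul_le_mul_of_nonneg_left (sub_rpow_le_mul_one_sub hp hwt0) hε.le
    have h4 := mul_le_mul_of_nonneg_left hv1 (mul_pos two_pos hc0).le
    have h5 : 2 * c * (1 - w t) = A * m * (1 - w t) - (p - 1) * ε * (1 - w t) := by
      rw [hc]; ring
    linarith [hode t]
  · have hCA : 2 * A * C₁ ≤ max 1 (max (1 / c) (2 * A * C₁)) :=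
      le_trans (le_max_right _ _) (le_max_right _ _)
    have h1 := mul_le_mul_of_nonneg_right hCA hE.le
    have hpow : w t ^ p ≤ w t := by
      simpa using Real.rpow_le_rpow_of_exponent_ge hwt0 hwt1.le hp.le
    have h2 := mul_le_mul_of_nonneg_left hpow hε.le
    have hwv : w t * (1 - w t) ≤ 1 - w t := mul_le_of_le_one_left (by linarith) hwt1.le
    have h3 := mul_le_mul_of_nonneg_left (hwv.trans hv2) (by positivity : 0 ≤ A * C₁)
    have h4 := mul_le_mul_of_nonneg_left hu hA.le
    linarith [hode t]
end

section
/- Let n ≥ 3 and β ∈ (0,π). Let (v_k) be a sequence of functions in C¹([0,β]) with v_k(β) = 0 and ∫₀^β sin^{n−2}(t) (v_k′(t)² + v_k(t)²) dt ≤ 1 for every k. Then there exist a subsequence (v_{k_j}) and a measurable function v : (0,β) → ℝ with ∫₀^β sin^{n−2}(t) v(t)² dt < ∞ such that ∫₀^β sin^{n−2}(t) (v_{k_j}(t) − v(t))² dt → 0 as j → ∞. -/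
open Real MeasureTheory Filter

theorem sin_mul_sin_le_sin {β s x : ℝ} (hβ : β < π) (hs : 0 ≤ s) (hsx : s ≤ x) (hx : x ≤ β) :
    sin β * sin s ≤ sin x := by
  have hβ0 : 0 ≤ sin β := sin_nonneg_of_nonneg_of_le_pi (by linarith) hβ.le
  have hs0 : 0 ≤ sin s := sin_nonneg_of_nonneg_of_le_pi hs (by linarith)
  rcases le_total x (π / 2) with h | h
  · have h1 : sin s ≤ sin x := sin_le_sin_of_le_of_le_pi_div_two (by linarith) h hsx
    nlinarith [sin_le_one β]
  · have h1 : sin β ≤ sin x := by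
      rw [← sin_pi_sub β, ← sin_pi_sub x]
      exact sin_le_sin_of_le_of_le_pi_div_two (by linarith) (by linarith) (by linarith)
    nlinarith [sin_le_one s]

/-- The Cauchy–Schwarz inequality against a constant function on an interval. -/
theorem sq_intervalIntegral_le {g : ℝ → ℝ} {s t : ℝ} (hst : s ≤ t)
    (hg : ContinuousOn g (Set.Icc s t)) :
    (∫ x in s..t, g x) ^ 2 ≤ (t - s) * ∫ x in s..t, g x ^ 2 := by
  rcases hst.eq_or_lt with rfl | hlt
  · simp
  have hi : IntervalIntegrable g volume s t := hg.intervalIntegrable_of_Icc hst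
  have hi2 : IntervalIntegrable (fun x => g x ^ 2) volume s t :=
    (hg.pow 2).intervalIntegrable_of_Icc hst
  set I := ∫ x in s..t, g x
  set a := I / (t - s)
  have h0 : 0 ≤ ∫ x in s..t, (g x - a) ^ 2 :=
    intervalIntegral.integral_nonneg hst fun x _ => sq_nonneg _
  have h1 : ∫ x in s..t, (g x - a) ^ 2 = (∫ x in s..t, g x ^ 2) - 2 * a * I + (t - s) * a ^ 2 := by
    have : ∀ x, (g x - a) ^ 2 = g x ^ 2 - 2 * a * g x + a ^ 2 := fun x => by ring
    simp_rw [this]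
    rw [intervalIntegral.integral_add (hi2.sub (hi.const_mul _)) (by simp),
      intervalIntegral.integral_sub hi2 (hi.const_mul _), intervalIntegral.integral_const_mul,
      intervalIntegral.integral_const, smul_eq_mul]
  have hpos : 0 < t - s := by linarith
  have ha : a * (t - s) = I := div_mul_cancel₀ _ hpos.ne'
  rw [h1] at h0
  have h2 := mul_nonneg hpos.le h0
  rw [← ha] at h2 ⊢
  linarith

/-- Functions of bounded weighted Dirichlet energy are Hölder continuous of order `1/2`, with a
constant that degenerates at `0` like the inverse weight. -/
theorem sin_pow_mul_sq_sub_le {m : ℕ} {β : ℝ} (hβ : β ∈ Set.Ioo 0 π) {f : ℝ → ℝ}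
    (hf : ContDiffOn ℝ 1 f (Set.Icc 0 β))
    (hbd : (∫ t in (0:ℝ)..β, sin t ^ m * ((deriv f t) ^ 2 + (f t) ^ 2)) ≤ 1)
    {s t : ℝ} (hs : 0 ≤ s) (hst : s ≤ t) (ht : t ≤ β) :
    sin β ^ m * sin s ^ m * (f t - f s) ^ 2 ≤ t - s := by
  have hβ0 := hβ.1
  set g := derivWithin f (Set.Icc 0 β)
  have hg : ContinuousOn g (Set.Icc 0 β) :=
    hf.continuousOn_derivWithin (uniqueDiffOn_Icc hβ0) le_rfl
  have hgd : ∀ x ∈ Set.Ioo 0 β, deriv f x = g x := fun x hx =>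
    (derivWithin_of_mem_nhds (Icc_mem_nhds hx.1 hx.2)).symm
  have hsub : Set.Icc s t ⊆ Set.Icc 0 β := Set.Icc_subset_Icc hs ht
  have hftc : ∫ x in s..t, g x = f t - f s := by
    refine intervalIntegral.integral_eq_sub_of_hasDerivAt_of_le hst (hf.continuousOn.mono hsub)
      (fun x hx => ?_) ((hg.mono hsub).intervalIntegrable_of_Icc hst)
    have hx' : x ∈ Set.Ioo 0 β := ⟨by linarith [hx.1], by linarith [hx.2]⟩
    rw [← hgd x hx']
    exact ((hf.differentiableOn one_ne_zero).differentiableAt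
      (Icc_mem_nhds hx'.1 hx'.2)).hasDerivAt
  have hsin : ∀ x ∈ Set.Icc 0 β, 0 ≤ sin x := fun x hx =>
    sin_nonneg_of_nonneg_of_le_pi hx.1 (by linarith [hx.2, hβ.2])
  have hE : ContinuousOn (fun x => sin x ^ m * (g x ^ 2 + f x ^ 2)) (Set.Icc 0 β) :=
    (continuous_sin.pow m).continuousOn.mul ((hg.pow 2).add (hf.continuousOn.pow 2))
  have hbd' : ∫ x in (0:ℝ)..β, sin x ^ m * (g x ^ 2 + f x ^ 2) ≤ 1 := by
    refine le_of_eq_of_le ?_ hbd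
    rw [intervalIntegral.integral_of_le hβ0.le, intervalIntegral.integral_of_le hβ0.le,
      integral_Ioc_eq_integral_Ioo, integral_Ioc_eq_integral_Ioo]
    exact setIntegral_congr_fun measurableSet_Ioo fun x hx => by simp only [hgd x hx]
  have hg2 : ContinuousOn (fun x => g x ^ 2) (Set.Icc s t) := (hg.mono hsub).pow 2
  have hmono : sin β ^ m * sin s ^ m * ∫ x in s..t, g x ^ 2 ≤ 1 := by
    rw [← intervalIntegral.integral_const_mul]
    calc ∫ x in s..t, sin β ^ m * sin s ^ m * g x ^ 2
        ≤ ∫ x in s..t, sin x ^ m * (g x ^ 2 + f x ^ 2) := by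
          refine intervalIntegral.integral_mono_on hst
            ((hg2.intervalIntegrable_of_Icc hst).const_mul _)
            ((hE.mono hsub).intervalIntegrable_of_Icc hst) fun x hx => ?_
          have h1 : sin β ^ m * sin s ^ m ≤ sin x ^ m := by
            rw [← mul_pow]
            exact pow_le_pow_left₀ (mul_nonneg (hsin _ ⟨hβ0.le, le_rfl⟩)
              (hsin _ ⟨hs, by linarith⟩)) (sin_mul_sin_le_sin hβ.2 hs hx.1 (by linarith [hx.2])) m
          have h2 : 0 ≤ sin x ^ m := pow_nonneg (hsin x (hsub hx)) m
          exact mul_le_mul h1 (by linarith [sq_nonneg (f x)]) (sq_nonneg _) h2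
      _ ≤ ∫ x in (0:ℝ)..β, sin x ^ m * (g x ^ 2 + f x ^ 2) := by
          refine intervalIntegral.integral_mono_interval hs hst ht ?_
            (hE.intervalIntegrable_of_Icc hβ0.le)
          refine (ae_restrict_iff' measurableSet_Ioc).2 (Eventually.of_forall fun x hx => ?_)
          exact mul_nonneg (pow_nonneg (hsin x ⟨hx.1.le, hx.2⟩) m) (by positivity)
      _ ≤ 1 := hbd'
  have hw : 0 ≤ sin β ^ m * sin s ^ m :=
    mul_nonneg (pow_nonneg (hsin _ ⟨hβ0.le, le_rfl⟩) m) (pow_nonneg (hsin _ ⟨hs, by linarith⟩) m)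
  have hcs := sq_intervalIntegral_le hst (hg.mono hsub)
  rw [hftc] at hcs
  calc sin β ^ m * sin s ^ m * (f t - f s) ^ 2
      ≤ sin β ^ m * sin s ^ m * ((t - s) * ∫ x in s..t, g x ^ 2) := by gcongr
    _ = (t - s) * (sin β ^ m * sin s ^ m * ∫ x in s..t, g x ^ 2) := by ring
    _ ≤ (t - s) * 1 := mul_le_mul_of_nonneg_left hmono (by linarith)
    _ = t - s := mul_one _

/-- Pointwise selection: a sequence that is pointwise bounded and uniformly right `1/2`-Hölder at
each point of an open interval has a subsequence converging at every point of that interval. -/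
theorem exists_subseq_tendsto_of_sq_sub_le {a b : ℝ} {v : ℕ → ℝ → ℝ} {c M : ℝ → ℝ}
    (hc : ∀ s ∈ Set.Ioo a b, 0 < c s)
    (hbdd : ∀ k, ∀ s ∈ Set.Ioo a b, |v k s| ≤ M s)
    (hv : ∀ k, ∀ s ∈ Set.Ioo a b, ∀ t ∈ Set.Ioo a b, s ≤ t →
      c s * (v k t - v k s) ^ 2 ≤ t - s) :
    ∃ φ : ℕ → ℕ, StrictMono φ ∧
      ∀ s ∈ Set.Ioo a b, ∃ l, Tendsto (fun j => v (φ j) s) atTop (nhds l) := by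
  classical
  let u : ℕ → ℚ → ℝ := fun k q => if (q : ℝ) ∈ Set.Ioo a b then v k q else 0
  have hcomp : IsCompact (Set.univ.pi fun q : ℚ => Set.Icc (-|M q|) |M q|) :=
    isCompact_univ_pi fun q => isCompact_Icc
  have hmem : ∀ k, u k ∈ Set.univ.pi fun q : ℚ => Set.Icc (-|M q|) |M q| := by
    intro k q _
    refine abs_le.1 ?_
    by_cases h : (q : ℝ) ∈ Set.Ioo a b
    · simpa only [u, if_pos h] using (hbdd k q h).trans (le_abs_self _)
    · simp only [u, if_neg h, abs_zero, abs_nonneg]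
  obtain ⟨l, -, φ, hφ, hl⟩ := hcomp.tendsto_subseq hmem
  rw [tendsto_pi_nhds] at hl
  refine ⟨φ, hφ, fun s hs => cauchySeq_tendsto_of_complete ?_⟩
  rw [Metric.cauchySeq_iff]
  intro ε hε
  have hcs := hc s hs
  have hδ : 0 < c s * (ε / 3) ^ 2 := by positivity
  obtain ⟨q, hq1, hq2⟩ := exists_rat_btwn (lt_min hs.2 (lt_add_of_pos_right s hδ))
  have hq : (q : ℝ) ∈ Set.Ioo a b := ⟨hs.1.trans hq1, hq2.trans_le (min_le_left _ _)⟩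
  have hclose : ∀ k, |v k q - v k s| < ε / 3 := by
    intro k
    have h1 := hv k s hs q hq hq1.le
    have h2 : (q : ℝ) < s + c s * (ε / 3) ^ 2 := hq2.trans_le (min_le_right _ _)
    have h3 : (v k q - v k s) ^ 2 < (ε / 3) ^ 2 :=
      lt_of_mul_lt_mul_left (by linarith) hcs.le
    exact abs_lt_of_sq_lt_sq h3 (by positivity)
  obtain ⟨N, hN⟩ := Metric.cauchySeq_iff.1 (hl q).cauchySeq (ε / 3) (by positivity)
  refine ⟨N, fun i hi j hj => ?_⟩
  have h := hN i hi j hj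
  simp only [Function.comp_apply, u, if_pos hq, Real.dist_eq] at h
  rw [Real.dist_eq]
  have h1 := abs_lt.1 (hclose (φ i))
  have h2 := abs_lt.1 (hclose (φ j))
  have h3 := abs_lt.1 h
  exact abs_lt.2 ⟨by linarith, by linarith⟩

/-- Compactness of the embedding of the weighted Dirichlet space on `(0,β)`
into the weighted `L²` space with weight `sin^{n−2} t`. -/
theorem stmt14 (n : ℕ) (hn : 3 ≤ n) (β : ℝ) (hβ : β ∈ Set.Ioo 0 π)
    (v : ℕ → ℝ → ℝ)
    (hreg : ∀ k, ContDiffOn ℝ 1 (v k) (Set.Icc 0 β))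
    (hzero : ∀ k, v k β = 0)
    (hbd : ∀ k, (∫ t in (0:ℝ)..β,
        Real.sin t ^ (n - 2) * ((deriv (v k) t) ^ 2 + (v k t) ^ 2)) ≤ 1) :
    ∃ φ : ℕ → ℕ, StrictMono φ ∧ ∃ w : ℝ → ℝ, Measurable w ∧
      MeasureTheory.IntegrableOn (fun t => Real.sin t ^ (n - 2) * (w t) ^ 2)
        (Set.Ioo 0 β) ∧
      Filter.Tendsto
        (fun j => ∫ t in (0:ℝ)..β, Real.sin t ^ (n - 2) * (v (φ j) t - w t) ^ 2)
        Filter.atTop (nhds 0) := by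
  have hβ0 := hβ.1
  generalize n - 2 = m at hbd ⊢
  have hsin : ∀ x ∈ Set.Ioo 0 β, 0 < sin x ^ m := fun x hx =>
    pow_pos (sin_pos_of_pos_of_lt_pi hx.1 (hx.2.trans hβ.2)) m
  have hsβ : 0 < sin β ^ m := pow_pos (sin_pos_of_pos_of_lt_pi hβ0 hβ.2) m
  have hkey := fun k => @sin_pow_mul_sq_sub_le m β hβ (v k) (hreg k) (hbd k)
  have hbound : ∀ k, ∀ s ∈ Set.Ioo 0 β, sin s ^ m * v k s ^ 2 ≤ β / sin β ^ m := by
    intro k s hs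
    have h := hkey k hs.1.le hs.2.le le_rfl
    rw [hzero k] at h
    rw [le_div_iff₀ hsβ]
    linarith [hs.1]
  obtain ⟨φ, hφ, hlim⟩ := exists_subseq_tendsto_of_sq_sub_le (a := 0) (b := β) (v := v)
    (c := fun s => sin β ^ m * sin s ^ m) (M := fun s => √(β / sin β ^ m / sin s ^ m))
    (fun s hs => mul_pos hsβ (hsin s hs))
    (fun k s hs => by
      refine abs_le_sqrt ?_
      rw [le_div_iff₀ (hsin s hs)]
      linarith [hbound k s hs])
    (fun k s hs t ht hst => hkey k hs.1.le hst ht.2.le)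
  have hlim' : ∀ s, ∃ l, Tendsto (fun j => (Set.Ioo 0 β).indicator (v (φ j)) s) atTop
      (nhds l) := by
    intro s
    by_cases hs : s ∈ Set.Ioo 0 β
    · simpa only [Set.indicator_of_mem hs] using hlim s hs
    · exact ⟨0, by simp only [Set.indicator_of_notMem hs, tendsto_const_nhds]⟩
  choose w hw using hlim'
  have hwm : Measurable w := by
    refine measurable_of_tendsto_metrizable (fun j => ?_) (tendsto_pi_nhds.2 hw)
    rw [← Set.piecewise_eq_indicator]
    exact ((hreg (φ j)).continuousOn.mono Set.Ioo_subset_Icc_self).measurable_piecewise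
      continuousOn_const measurableSet_Ioo
  have hwt : ∀ s ∈ Set.Ioo 0 β, Tendsto (fun j => v (φ j) s) atTop (nhds (w s)) := by
    intro s hs
    simpa only [Set.indicator_of_mem hs] using hw s
  have hwb : ∀ s ∈ Set.Ioo 0 β, sin s ^ m * w s ^ 2 ≤ β / sin β ^ m := fun s hs =>
    le_of_tendsto (((hwt s hs).pow 2).const_mul _) (Eventually.of_forall fun j => hbound _ s hs)
  have hsm : Measurable fun s => sin s ^ m := (continuous_sin.pow m).measurable
  refine ⟨φ, hφ, w, hwm, ?_, ?_⟩
  · refine Measure.integrableOn_of_bounded (M := β / sin β ^ m) (by simp)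
      (hsm.mul (hwm.pow_const 2)).aestronglyMeasurable ?_
    refine (ae_restrict_iff' measurableSet_Ioo).2 (Eventually.of_forall fun s hs => ?_)
    rw [norm_of_nonneg (mul_nonneg (hsin s hs).le (sq_nonneg _))]
    exact hwb s hs
  · simp_rw [intervalIntegral.integral_of_le hβ0.le, integral_Ioc_eq_integral_Ioo]
    suffices h : Tendsto (fun j => ∫ t in Set.Ioo 0 β, sin t ^ m * (v (φ j) t - w t) ^ 2) atTop
        (nhds (∫ _ in Set.Ioo 0 β, (0 : ℝ))) by simpa only [integral_zero] using h
    refine tendsto_integral_of_dominated_convergence (fun _ => 4 * (β / sin β ^ m))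
      (fun j => ?_) ?_ (fun j => ?_) ?_
    · refine hsm.aestronglyMeasurable.mul (AEStronglyMeasurable.pow (AEStronglyMeasurable.sub ?_
        hwm.aestronglyMeasurable) 2)
      exact ((hreg (φ j)).continuousOn.mono Set.Ioo_subset_Icc_self).aestronglyMeasurable
        measurableSet_Ioo
    · exact integrable_const _
    · refine (ae_restrict_iff' measurableSet_Ioo).2 (Eventually.of_forall fun s hs => ?_)
      rw [norm_of_nonneg (mul_nonneg (hsin s hs).le (sq_nonneg _))]
      have h := mul_nonneg (hsin s hs).le (sq_nonneg (v (φ j) s + w s))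
      linarith [hbound (φ j) s hs, hwb s hs]
    · refine (ae_restrict_iff' measurableSet_Ioo).2 (Eventually.of_forall fun s hs => ?_)
      simpa using (((hwt s hs).sub_const (w s)).pow 2).const_mul (sin s ^ m)
end
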